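/- arXiv:2312.05914 — 2 statements merged into one kernel-verified Lean document; each statement's English description precedes it below -/
import Mathlib

section
/- Let R be a commutative Noetherian local ring, C a semidualizing R-module, and M a finitely generated R-module belonging to the Auslander class A_C(R) such that Hom_R(M,M) has finite C-injective dimension. If Ext_R^i(M,R) = 0 and Ext_R^i(M,M) = 0 for all i ≥ 1, then M is free. (That is, the Auslander-Reiten conjecture holds for finitely generated modules M ∈ A_C(R) with I_C-id_R(Hom_R(M,M)) < ∞.) -/
open CategoryTheory

noncomputable section

/-- The `i`-th Ext module of two `R`-modules. -/
def extMod (R : Type) [CommRing R] (i : ℕ) (M N : Type) [AddCommGroup M] [Module R M]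
    [AddCommGroup N] [Module R N] : ModuleCat R :=
  ((Ext R (ModuleCat R) i).obj (Opposite.op (ModuleCat.of R M))).obj (ModuleCat.of R N)

/-- The `i`-th Tor module of two `R`-modules. -/
def torMod (R : Type) [CommRing R] (i : ℕ) (M N : Type) [AddCommGroup M] [Module R M]
    [AddCommGroup N] [Module R N] : ModuleCat R :=
  ((Tor (ModuleCat R) i).obj (ModuleCat.of R M)).obj (ModuleCat.of R N)

/-- The depth of a module over a local ring: the infimum of the set of
indices `i` with `Ext^i(R/𝔪, N) ≠ 0`. -/
def moduleDepth (R : Type) [CommRing R] [IsLocalRing R] (N : Type) [AddCommGroup N]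
    [Module R N] : ℕ :=
  sInf {i : ℕ | ¬ Subsingleton (extMod R i (R ⧸ IsLocalRing.maximalIdeal R) N)}

/-- An `R`-module `N` has finite injective dimension iff there is an `n` such that
`Ext^i(M, N) = 0` for all modules `M` and all `i > n`. -/
def HasFiniteInjDim (R : Type) [CommRing R] (N : Type) [AddCommGroup N] [Module R N] : Prop :=
  ∃ n : ℕ, ∀ (M : Type) [AddCommGroup M] [Module R M], ∀ i : ℕ, n < i →
    Subsingleton (extMod R i M N)

/-- An `R`-module `M` has finite projective dimension iff there is an `n` such that
`Ext^i(M, N) = 0` for all modules `N` and all `i > n`. -/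
def HasFiniteProjDim (R : Type) [CommRing R] (M : Type) [AddCommGroup M] [Module R M] : Prop :=
  ∃ n : ℕ, ∀ (N : Type) [AddCommGroup N] [Module R N], ∀ i : ℕ, n < i →
    Subsingleton (extMod R i M N)

/-- The `𝔪`-torsion submodule `Γ_𝔪(M)` of a module over a local ring. -/
def mTorsion (R : Type) [CommRing R] [IsLocalRing R] (M : Type) [AddCommGroup M]
    [Module R M] : Submodule R M :=
  ⨆ n : ℕ, Submodule.torsionBySet R M ((IsLocalRing.maximalIdeal R ^ n : Ideal R) : Set R)

/-- A semidualizing module: the natural map `R → Hom(C,C)` is bijective and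
`Ext^i(C,C) = 0` for all `i ≥ 1`. -/
structure IsSemidualizing (R : Type) [CommRing R] (C : Type) [AddCommGroup C]
    [Module R C] : Prop where
  bijective : Function.Bijective (LinearMap.lsmul R C)
  ext_vanish : ∀ i : ℕ, 1 ≤ i → Subsingleton (extMod R i C C)

/-- Membership in the Auslander class `A_C(R)`: the natural map `M → Hom(C, C ⊗ M)` is
bijective, `Tor_i(C, M) = 0` and `Ext^i(C, C ⊗ M) = 0` for all `i ≥ 1`. -/
structure MemAuslanderClass (R : Type) [CommRing R] (C : Type) [AddCommGroup C] [Module R C]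
    (M : Type) [AddCommGroup M] [Module R M] : Prop where
  bijective : Function.Bijective ((TensorProduct.mk R C M).flip)
  tor_vanish : ∀ i : ℕ, 1 ≤ i → Subsingleton (torMod R i C M)
  ext_vanish : ∀ i : ℕ, 1 ≤ i → Subsingleton (extMod R i C (TensorProduct R C M))

/-- A module `N` is Tor-rigid if for every finitely generated module `M` and every `i ≥ 1`,
`Tor_i(M, N) = 0` implies `Tor_{i+1}(M, N) = 0`. -/
def IsTorRigid (R : Type) [CommRing R] (N : Type) [AddCommGroup N] [Module R N] : Prop :=
  ∀ (M : Type) [AddCommGroup M] [Module R M], Module.Finite R M →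
    ∀ i : ℕ, 1 ≤ i → Subsingleton (torMod R i M N) → Subsingleton (torMod R (i + 1) M N)

/-- The natural map `C ⊗ Hom(M,N) → Hom(M, C ⊗ N)`, sending `c ⊗ φ` to `m ↦ c ⊗ φ m`. -/
def homTensorMap (R : Type) [CommRing R] (C M N : Type) [AddCommGroup C] [Module R C]
    [AddCommGroup M] [Module R M] [AddCommGroup N] [Module R N] :
    TensorProduct R C (M →ₗ[R] N) →ₗ[R] (M →ₗ[R] TensorProduct R C N) :=
  TensorProduct.lift
    ((LinearMap.llcomp R M N (TensorProduct R C N)).comp (TensorProduct.mk R C N))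

namespace AuslanderReiten
open Abelian

section API
variable {R : Type} [CommRing R]

/-- Vanishing of the `n`-th Ext group (in the derived category sense). -/
abbrev ExtVanish (R : Type) [CommRing R] (n : ℕ) (X Y : Type) [AddCommGroup X] [Module R X]
    [AddCommGroup Y] [Module R Y] : Prop :=
  Subsingleton (Abelian.Ext.{0} (ModuleCat.of R X) (ModuleCat.of R Y) n)

variable {X Y Z A B D : Type} [AddCommGroup X] [Module R X] [AddCommGroup Y] [Module R Y]
  [AddCommGroup Z] [Module R Z] [AddCommGroup A] [Module R A] [AddCommGroup B] [Module R B]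
  [AddCommGroup D] [Module R D]

/-- Vanishing of the derived-functor Ext implies vanishing of the derived-category Ext. -/
lemma extVanish_of_extMod {n : ℕ} (h : Subsingleton (extMod R (n + 1) X Y)) :
    ExtVanish R (n + 1) X Y := by
  obtain ⟨P⟩ := (inferInstance : HasProjectiveResolution (ModuleCat.of R X)).out
  have h1 : Limits.IsZero ((P.complex.linearYonedaObj R (ModuleCat.of R Y)).homology (n + 1)) := by
    refine Limits.IsZero.of_iso ?_ (P.isoExt (R := R) (n + 1) (ModuleCat.of R Y)).symm
    exact @ModuleCat.isZero_of_subsingleton _ _ _ h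
  refine subsingleton_of_forall_eq 0 fun x => ?_
  obtain ⟨f, hf, rfl⟩ := P.extMk_surjective x (n + 2) rfl
  rw [← HomologicalComplex.exactAt_iff_isZero_homology,
    HomologicalComplex.exactAt_iff' _ n (n + 1) (n + 2) (by simp) (by simp),
    ShortComplex.moduleCat_exact_iff] at h1
  rw [P.extMk_eq_zero_iff _ _ _ _ n rfl]
  exact h1 f hf

/-- A short exact sequence of modules, given by linear maps. -/
structure IsSES (f : A →ₗ[R] B) (g : B →ₗ[R] D) : Prop where
  inj : Function.Injective f
  surj : Function.Surjective g
  exact : Function.Exact f g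

/-- The short complex in `ModuleCat R` attached to a short exact sequence of linear maps. -/
abbrev IsSES.complex {f : A →ₗ[R] B} {g : B →ₗ[R] D} (h : IsSES f g) :
    ShortComplex (ModuleCat.{0} R) :=
  ShortComplex.mk (ModuleCat.ofHom f) (ModuleCat.ofHom g)
    (by ext x; exact h.exact.apply_apply_eq_zero x)

lemma IsSES.shortExact {f : A →ₗ[R] B} {g : B →ₗ[R] D} (h : IsSES f g) :
    h.complex.ShortExact where
  exact := (ShortComplex.ShortExact.moduleCat_exact_iff_function_exact _).2 h.exact
  mono_f := (ModuleCat.mono_iff_injective _).2 h.inj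
  epi_g := (ModuleCat.epi_iff_surjective _).2 h.surj

lemma isSES_subtype_mkQ (N : Submodule R B) : IsSES N.subtype N.mkQ :=
  ⟨N.injective_subtype, N.mkQ_surjective, LinearMap.exact_subtype_mkQ N⟩

lemma isSES_ker (g : B →ₗ[R] D) (hg : Function.Surjective g) :
    IsSES (LinearMap.ker g).subtype g :=
  ⟨Submodule.injective_subtype _, hg, LinearMap.exact_subtype_ker_map g⟩

section LongExact
variable {f : A →ₗ[R] B} {g : B →ₗ[R] D}

lemma IsSES.extVanish_right (h : IsSES f g) {n : ℕ}
    (hB : ExtVanish R n X B) (hA : ExtVanish R (n + 1) X A) :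
    ExtVanish R n X D := by
  refine subsingleton_of_forall_eq 0 fun x => ?_
  obtain ⟨y, rfl⟩ := Ext.covariant_sequence_exact₃ (ModuleCat.of R X) h.shortExact x rfl
    (hA.elim _ _)
  rw [hB.elim y 0, Ext.zero_comp]

lemma IsSES.extVanish_quotient (h : IsSES f g) {n : ℕ}
    (hA : ExtVanish R n A Y) (hB : ExtVanish R (n + 1) B Y) :
    ExtVanish R (n + 1) D Y := by
  refine subsingleton_of_forall_eq 0 fun x => ?_
  obtain ⟨y, rfl⟩ := Ext.contravariant_sequence_exact₃ h.shortExact (ModuleCat.of R Y) x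
    (hB.elim _ _) (add_comm 1 n)
  rw [hA.elim y 0, Ext.comp_zero]

lemma IsSES.extVanish_sub (h : IsSES f g) {n : ℕ}
    (hB : ExtVanish R n B Y) (hD : ExtVanish R (n + 1) D Y) :
    ExtVanish R n A Y := by
  refine subsingleton_of_forall_eq 0 fun x => ?_
  obtain ⟨y, rfl⟩ := Ext.contravariant_sequence_exact₁ h.shortExact (ModuleCat.of R Y) x
    (add_comm 1 n) (hD.elim _ _)
  rw [hB.elim y 0, Ext.comp_zero]

lemma IsSES.exists_lift (h : IsSES f g) (hA : ExtVanish R 1 X A) (φ : X →ₗ[R] D) :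
    ∃ ψ : X →ₗ[R] B, g ∘ₗ ψ = φ := by
  obtain ⟨y, hy⟩ := Ext.covariant_sequence_exact₃ (ModuleCat.of R X) h.shortExact
    (Ext.mk₀ (ModuleCat.ofHom φ)) rfl (hA.elim _ _)
  obtain ⟨ψ, rfl⟩ := Ext.mk₀_bijective _ _ |>.2 y
  rw [Ext.mk₀_comp_mk₀] at hy
  have := (Ext.mk₀_bijective _ _).1 hy
  exact ⟨ψ.hom, by simpa using congrArg ModuleCat.Hom.hom this⟩

lemma IsSES.exists_extension (h : IsSES f g) (hD : ExtVanish R 1 D Y) (φ : A →ₗ[R] Y) :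
    ∃ ψ : B →ₗ[R] Y, ψ ∘ₗ f = φ := by
  obtain ⟨y, hy⟩ := Ext.contravariant_sequence_exact₁ h.shortExact (ModuleCat.of R Y)
    (Ext.mk₀ (ModuleCat.ofHom φ)) (add_zero 1) (hD.elim _ _)
  obtain ⟨ψ, rfl⟩ := Ext.mk₀_bijective _ _ |>.2 y
  rw [Ext.mk₀_comp_mk₀] at hy
  have := (Ext.mk₀_bijective _ _).1 hy
  exact ⟨ψ.hom, by simpa using congrArg ModuleCat.Hom.hom this⟩

lemma IsSES.extVanish_one (h : IsSES f g) (hB : ExtVanish R 1 B Y)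
    (H : ∀ φ : A →ₗ[R] Y, ∃ ψ : B →ₗ[R] Y, ψ ∘ₗ f = φ) : ExtVanish R 1 D Y := by
  refine subsingleton_of_forall_eq 0 fun x => ?_
  obtain ⟨y, rfl⟩ := Ext.contravariant_sequence_exact₃ h.shortExact (ModuleCat.of R Y) x
    (hB.elim _ _) (add_zero 1)
  obtain ⟨φ, rfl⟩ := Ext.mk₀_bijective _ _ |>.2 y
  obtain ⟨ψ, hψ⟩ := H φ.hom
  have : φ = ModuleCat.ofHom f ≫ ModuleCat.ofHom ψ := by
    ext x; exact (LinearMap.congr_fun hψ x).symm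
  rw [this, ← Ext.mk₀_comp_mk₀]
  exact h.shortExact.extClass_comp_assoc _

end LongExact

lemma extVanish_of_projective [Module.Projective R X] (n : ℕ) : ExtVanish R (n + 1) X Y :=
  have : Projective (ModuleCat.of R X) := ModuleCat.projective_of_categoryTheory_projective _
  Ext.subsingleton_of_projective _ _ _

lemma extVanish_zero_iff : ExtVanish R 0 X Y ↔ Subsingleton (X →ₗ[R] Y) :=
  (Ext.addEquiv₀.trans ModuleCat.homAddEquiv).toEquiv.subsingleton_congr

/-- Ext into a retract of a finite sum of copies of `Z` vanishes if Ext into `Z` does. -/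
lemma ExtVanish.of_sum_right {n : ℕ} (h : ExtVanish R n X Z) {ι : Type} [Fintype ι]
    (p : ι → Y →ₗ[R] Z) (j : ι → Z →ₗ[R] Y) (hpj : ∑ i, j i ∘ₗ p i = LinearMap.id) :
    ExtVanish R n X Y := by
  refine subsingleton_of_forall_eq 0 fun x => ?_
  have h1 : (𝟙 (ModuleCat.of R Y)) = ∑ i, ModuleCat.ofHom (p i) ≫ ModuleCat.ofHom (j i) := by
    ext y
    simpa [ModuleCat.hom_sum] using (LinearMap.congr_fun hpj y).symm
  rw [← Ext.comp_mk₀_id x, h1, Ext.mk₀_sum, Ext.comp_sum]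
  refine Finset.sum_eq_zero fun i _ => ?_
  rw [← Ext.mk₀_comp_mk₀, ← Ext.comp_assoc (a₁₂ := n) _ _ _ (by lia) (by lia) (by lia),
    h.elim (x.comp _ _) 0, Ext.zero_comp]

lemma ExtVanish.of_sum_left {n : ℕ} (h : ExtVanish R n Z X) {ι : Type} [Fintype ι]
    (p : ι → Y →ₗ[R] Z) (j : ι → Z →ₗ[R] Y) (hpj : ∑ i, j i ∘ₗ p i = LinearMap.id) :
    ExtVanish R n Y X := by
  refine subsingleton_of_forall_eq 0 fun x => ?_
  have h1 : (𝟙 (ModuleCat.of R Y)) = ∑ i, ModuleCat.ofHom (p i) ≫ ModuleCat.ofHom (j i) := by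
    ext y
    simpa [ModuleCat.hom_sum] using (LinearMap.congr_fun hpj y).symm
  rw [← Ext.mk₀_id_comp x, h1, Ext.mk₀_sum, Ext.sum_comp]
  refine Finset.sum_eq_zero fun i _ => ?_
  rw [← Ext.mk₀_comp_mk₀, Ext.comp_assoc (a₂₃ := n) _ _ _ (by lia) (by lia) (by lia),
    h.elim ((Ext.mk₀ (ModuleCat.ofHom (j i))).comp _ _) 0, Ext.comp_zero]

lemma ExtVanish.congr_right {n : ℕ} (h : ExtVanish R n X Z) (e : Z ≃ₗ[R] Y) :
    ExtVanish R n X Y :=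
  h.of_sum_right (ι := Unit) (fun _ => e.symm) (fun _ => e) (by ext; simp)

section Free
variable {ι : Type} [Fintype ι]

lemma ExtVanish.hom_right {n : ℕ} (h : ExtVanish R n X Z) : ExtVanish R n X ((ι → R) →ₗ[R] Z) := by
  classical
  exact h.of_sum_right (fun i => LinearMap.applyₗ (Pi.single i (1 : R)))
    (fun i => LinearMap.smulRightₗ (LinearMap.proj i)) (by ext; simp [Pi.single_apply])

lemma ExtVanish.hom_left {n : ℕ} (h : ExtVanish R n Z X) : ExtVanish R n ((ι → R) →ₗ[R] Z) X := by
  classical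
  exact h.of_sum_left (fun i => LinearMap.applyₗ (Pi.single i (1 : R)))
    (fun i => LinearMap.smulRightₗ (LinearMap.proj i)) (by ext; simp [Pi.single_apply])

lemma ExtVanish.pi_right {n : ℕ} (h : ExtVanish R n X Z) : ExtVanish R n X (ι → Z) := by
  classical
  exact h.of_sum_right (fun i => LinearMap.proj i) (fun i => LinearMap.single R (fun _ => Z) i)
    (by ext i z j; by_cases hij : j = i <;> simp [Pi.single_apply])

end Free

lemma IsSES.exact_lcomp {f : A →ₗ[R] B} {g : B →ₗ[R] D} (h : IsSES f g) :
    Function.Exact (LinearMap.lcomp R Y g) (LinearMap.lcomp R Y f) := by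
  refine fun φ => ⟨fun hφ => ?_, ?_⟩
  · refine ⟨(LinearMap.range f).liftQ φ ?_ ∘ₗ
      (h.exact.linearEquivOfSurjective h.surj).symm.toLinearMap, ?_⟩
    · rintro _ ⟨a, rfl⟩
      exact LinearMap.congr_fun hφ a
    · ext b
      have : (h.exact.linearEquivOfSurjective h.surj).symm (g b) =
          Submodule.Quotient.mk b := by
        rw [LinearEquiv.symm_apply_eq]; rfl
      simp [this]
  · rintro ⟨ψ, rfl⟩
    ext a
    simp [h.exact.apply_apply_eq_zero]

lemma IsSES.injective_lcomp {f : A →ₗ[R] B} {g : B →ₗ[R] D} (h : IsSES f g) :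
    Function.Injective (LinearMap.lcomp R Y g) := fun φ ψ hφ => by
  ext d
  obtain ⟨b, rfl⟩ := h.surj d
  exact LinearMap.congr_fun hφ b

lemma IsSES.dual {f : A →ₗ[R] B} {g : B →ₗ[R] D} (h : IsSES f g) (hD : ExtVanish R 1 D Y) :
    IsSES (LinearMap.lcomp R Y g) (LinearMap.lcomp R Y f) :=
  ⟨h.injective_lcomp, h.exists_extension hD, h.exact_lcomp⟩

lemma IsSES.hom {f : A →ₗ[R] B} {g : B →ₗ[R] D} (h : IsSES f g) (hA : ExtVanish R 1 X A) :
    IsSES (LinearMap.compRight R f : (X →ₗ[R] A) →ₗ[R] _) (LinearMap.compRight R g) where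
  inj φ ψ hφ := by
    ext x
    exact h.inj (LinearMap.congr_fun hφ x)
  surj φ := h.exists_lift hA φ
  exact φ := by
    refine ⟨fun hφ => ?_, ?_⟩
    · have hx : ∀ x, φ x ∈ LinearMap.range f := fun x =>
        (h.exact _).1 (LinearMap.congr_fun hφ x)
      refine ⟨(LinearEquiv.ofInjective f h.inj).symm.toLinearMap ∘ₗ φ.codRestrict _ hx, ?_⟩
      ext x
      exact congrArg Subtype.val
        ((LinearEquiv.ofInjective f h.inj).apply_symm_apply (φ.codRestrict _ hx x))
    · rintro ⟨ψ, rfl⟩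
      ext x
      simp [h.exact.apply_apply_eq_zero]

/-- A module generated by `b` elements, `b` minimal, is covered by `R ^ b` with kernel
inside the maximal ideal. -/
lemma exists_minimal_cover (R : Type) [CommRing R] [IsLocalRing R] (X : Type) [AddCommGroup X]
    [Module R X] [Module.Finite R X] : ∃ (b : ℕ) (p : (Fin b → R) →ₗ[R] X),
      Function.Surjective p ∧
      LinearMap.ker p ≤ IsLocalRing.maximalIdeal R • (⊤ : Submodule R (Fin b → R)) := by
  classical
  have hex : ∃ b : ℕ, ∃ p : (Fin b → R) →ₗ[R] X, Function.Surjective p :=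
    Module.Finite.exists_fin' R X
  obtain ⟨p, hp⟩ := Nat.find_spec hex
  refine ⟨Nat.find hex, p, hp, fun r hr => ?_⟩
  have hm : ∀ i, r i ∈ IsLocalRing.maximalIdeal R := by
    intro i
    by_contra hi
    have hu : IsUnit (r i) := by simpa using hi
    obtain ⟨c, hc⟩ := hu.exists_left_inv
    obtain ⟨b', hb'⟩ := Nat.exists_eq_succ_of_ne_zero (n := Nat.find hex) (by
      intro h0; exact (Fin.cast h0 i).elim0)
    have hlt : b' < Nat.find hex := by omega
    refine Nat.find_min hex hlt ?_
    let e : (Fin b' → R) →ₗ[R] (Fin (Nat.find hex) → R) :=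
      LinearMap.pi fun k => if hk : k = i then 0 else
        LinearMap.proj ((finSuccAboveEquiv (Fin.cast hb' i)).symm
          ⟨Fin.cast hb' k, by simpa using hk⟩)
    refine ⟨p ∘ₗ e, fun x => ?_⟩
    obtain ⟨w, rfl⟩ := hp x
    let w' := w - (w i * c) • r
    refine ⟨fun l => w' (Fin.cast hb'.symm ((Fin.cast hb' i).succAbove l)), ?_⟩
    have hr' : p r = 0 := hr
    have hpw : p w = p w' := by simp [w', hr']
    rw [hpw, LinearMap.comp_apply]
    congr 1
    ext k
    by_cases hk : k = i
    · subst hk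
      simp [e, w', mul_assoc, hc]
    · simp only [e, LinearMap.pi_apply, dif_neg hk, LinearMap.proj_apply]
      congr 1
      have := (finSuccAboveEquiv (Fin.cast hb' i)).apply_symm_apply
        ⟨Fin.cast hb' k, by simpa using hk⟩
      rw [finSuccAboveEquiv_apply] at this
      replace this : (Fin.cast hb' i).succAbove ((finSuccAboveEquiv (Fin.cast hb' i)).symm
          ⟨Fin.cast hb' k, by simpa using hk⟩) = Fin.cast hb' k := congrArg Subtype.val this
      simp [this]
  rw [pi_eq_sum_univ r]
  exact Submodule.sum_mem _ fun i _ => Submodule.smul_mem_smul (hm i) trivial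

end API

section ResidueField
open IsLocalRing
open scoped Pointwise

lemma comp_lcomp_eq_zero {R : Type} [CommRing R] [IsLocalRing R] {F L Y : Type}
    [AddCommGroup F] [Module R F] [AddCommGroup L] [Module R L] [AddCommGroup Y] [Module R Y]
    (ι : L →ₗ[R] F) (hι : LinearMap.range ι ≤ maximalIdeal R • (⊤ : Submodule R F))
    (φ : (R ⧸ maximalIdeal R) →ₗ[R] (F →ₗ[R] Y)) : LinearMap.lcomp R Y ι ∘ₗ φ = 0 := by
  ext l
  change φ 1 (ι l) = 0
  refine Submodule.smul_induction_on (p := fun v => φ 1 v = 0) (hι ⟨l, rfl⟩) ?_ ?_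
  · intro a ha v _
    have h0 : a • (1 : R ⧸ maximalIdeal R) = 0 := by
      rw [Algebra.smul_def, mul_one]
      exact Ideal.Quotient.eq_zero_iff_mem.2 ha
    rw [map_smul, ← LinearMap.smul_apply, ← map_smul, h0, map_zero, LinearMap.zero_apply]
  · intro v w hv hw
    rw [map_add, hv, hw, add_zero]

lemma ext_comp_lcomp_eq_zero {R : Type} [CommRing R] [IsLocalRing R] {b : ℕ} {L : Type}
    [AddCommGroup L] [Module R L] (ι : L →ₗ[R] (Fin b → R))
    (hι : LinearMap.range ι ≤ maximalIdeal R • (⊤ : Submodule R (Fin b → R))) (n : ℕ) :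
    ∀ (Y : Type) [AddCommGroup Y] [Module R Y], (∀ i, ExtVanish R (i + 1) L Y) →
    ∀ x : Ext.{0} (ModuleCat.of R (R ⧸ maximalIdeal R)) (ModuleCat.of R ((Fin b → R) →ₗ[R] Y)) n,
      x.comp (Ext.mk₀ (ModuleCat.ofHom (LinearMap.lcomp R Y ι))) (add_zero n) = 0 := by
  induction n with
  | zero =>
    intro Y _ _ hL x
    obtain ⟨φ, rfl⟩ := (Ext.mk₀_bijective _ _).2 x
    have h0 : φ ≫ ModuleCat.ofHom (LinearMap.lcomp R Y ι) = 0 := by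
      ext1
      exact comp_lcomp_eq_zero ι hι φ.hom
    rw [Ext.mk₀_comp_mk₀, h0, Ext.mk₀_zero]
  | succ n ih =>
    intro Y _ _ hL x
    let J : ModuleCat.{0} R := Injective.under (ModuleCat.of R Y)
    let u : Y →ₗ[R] J := (Injective.ι (ModuleCat.of R Y)).hom
    have hu : Function.Injective u :=
      (ModuleCat.mono_iff_injective (Injective.ι (ModuleCat.of R Y))).1 inferInstance
    let v := (LinearMap.range u).mkQ
    have h : IsSES u v :=
      ⟨hu, Submodule.mkQ_surjective _, LinearMap.exact_map_mkQ_range u⟩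
    have hJ : ∀ (m : ℕ) (X : Type) [AddCommGroup X] [Module R X], ExtVanish R (m + 1) X J := by
      intro m X _ _
      exact Ext.subsingleton_of_injective _ J _
    have hF : IsSES (LinearMap.compRight R u : ((Fin b → R) →ₗ[R] Y) →ₗ[R] _)
        (LinearMap.compRight R v) := h.hom (extVanish_of_projective 0)
    have hLL : IsSES (LinearMap.compRight R u : (L →ₗ[R] Y) →ₗ[R] _)
        (LinearMap.compRight R v) := h.hom (hL 0)
    let τ : hF.complex ⟶ hLL.complex :=
      { τ₁ := ModuleCat.ofHom (LinearMap.lcomp R Y ι)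
        τ₂ := ModuleCat.ofHom (LinearMap.lcomp R J ι)
        τ₃ := ModuleCat.ofHom (LinearMap.lcomp R _ ι)
        comm₁₂ := rfl
        comm₂₃ := rfl }
    obtain ⟨y, rfl⟩ := Ext.covariant_sequence_exact₁ _ hF.shortExact x
      (((hJ n _).hom_right : ExtVanish R (n + 1) (R ⧸ maximalIdeal R)
        ((Fin b → R) →ₗ[R] J)).elim _ _) rfl
    have hnat := ShortComplex.ShortExact.extClass_naturality hF.shortExact hLL.shortExact τ
    have hy := ih (J ⧸ LinearMap.range u)
      (fun i => h.extVanish_right (hJ i L) (hL (i + 1))) y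
    change (y.comp hF.shortExact.extClass rfl).comp (Ext.mk₀ τ.τ₁) _ = 0
    change y.comp (Ext.mk₀ τ.τ₃) _ = 0 at hy
    rw [Ext.comp_assoc (a₂₃ := 1) _ _ _ (by lia) (by lia) (by lia), hnat,
      ← Ext.comp_assoc (a₁₂ := n) _ _ _ (by lia) (by lia) (by lia), hy, Ext.zero_comp]

/-- A finitely generated module over a Noetherian local ring all of whose Ext groups from the
residue field vanish is zero. -/
lemma subsingleton_of_extVanish_residue {R : Type} [CommRing R] [IsNoetherianRing R]
    [IsLocalRing R] (N : Type) [AddCommGroup N] [Module R N] [Module.Finite R N]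
    (h : ∀ n, ExtVanish R n (R ⧸ maximalIdeal R) N) : Subsingleton N := by
  suffices H : ∀ K : Submodule R N, (∀ n, ExtVanish R n (R ⧸ maximalIdeal R) (N ⧸ K)) →
      K = ⊤ by
    have := H ⊥ fun n => (h n).congr_right (Submodule.quotEquivOfEqBot ⊥ rfl).symm
    exact (Submodule.subsingleton_iff R).1 (subsingleton_of_bot_eq_top this)
  intro K
  induction K using IsNoetherian.induction with
  | hgt K ih =>
  intro hK
  obtain ⟨r, hr, hreg⟩ := IsSMulRegular.subsingleton_linearMap_iff.1
    (extVanish_zero_iff.1 (hK 0))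
  rw [Ideal.annihilator_quotient] at hr
  let K' : Submodule R N := (r • (⊤ : Submodule R N)) ⊔ K
  have hle : K ≤ K' := le_sup_right
  have hses : IsSES (LinearMap.lsmul R (N ⧸ K) r) (Submodule.factor hle) := by
    refine ⟨hreg, Submodule.factor_surjective hle, fun x => ?_⟩
    obtain ⟨x, rfl⟩ := Submodule.Quotient.mk_surjective K x
    change Submodule.Quotient.mk x = 0 ↔ _
    rw [Submodule.Quotient.mk_eq_zero]
    constructor
    · intro hx
      obtain ⟨y, hy, z, hz, rfl⟩ := Submodule.mem_sup.1 hx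
      obtain ⟨w, -, rfl⟩ := Submodule.mem_smul_pointwise_iff_exists _ _ _ |>.1 hy
      refine ⟨Submodule.Quotient.mk w, ?_⟩
      simp [(Submodule.Quotient.mk_eq_zero K).2 hz]
    · rintro ⟨w, hw⟩
      obtain ⟨w, rfl⟩ := Submodule.Quotient.mk_surjective K w
      rw [LinearMap.lsmul_apply, ← Submodule.Quotient.mk_smul, Submodule.Quotient.eq] at hw
      have h1 := Submodule.sub_mem _
        ((le_sup_left : _ ≤ K') (Submodule.smul_mem_pointwise_smul w r ⊤ trivial)) (hle hw)
      simpa using h1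
  have hK' : ∀ n, ExtVanish R n (R ⧸ maximalIdeal R) (N ⧸ K') := fun n =>
    hses.extVanish_right (hK n) (hK (n + 1))
  by_contra hne
  have htop : K' = ⊤ := by
    rcases hle.eq_or_lt with he | hlt
    · have : ∀ x : N ⧸ K, r • x = 0 := fun x => by
        obtain ⟨x, rfl⟩ := Submodule.Quotient.mk_surjective K x
        rw [← Submodule.Quotient.mk_smul, Submodule.Quotient.mk_eq_zero, he]
        exact (le_sup_left : _ ≤ K') (Submodule.smul_mem_pointwise_smul x r ⊤ trivial)
      have hs : Subsingleton (N ⧸ K) := ⟨fun x y => hreg (by simp [this])⟩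
      exact absurd (Submodule.Quotient.subsingleton_iff.1 hs) hne
    · exact ih K' hlt hK'
  refine hne (top_le_iff.1 ?_)
  refine Submodule.le_of_le_smul_of_le_jacobson_bot (I := maximalIdeal R) Module.Finite.fg_top
    (maximalIdeal_le_jacobson _) ?_
  refine htop.ge.trans ?_
  refine sup_le (le_sup_of_le_right ?_) le_sup_left
  rintro _ ⟨x, -, rfl⟩
  exact Submodule.smul_mem_smul hr trivial

end ResidueField

section Projective
open IsLocalRing

lemma extVanish_hom_ker {R : Type} [CommRing R] [IsLocalRing R] {X D : Type} [AddCommGroup X]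
    [Module R X] [AddCommGroup D] [Module R D] {b : ℕ} (p : (Fin b → R) →ₗ[R] X)
    (hp : Function.Surjective p)
    (hker : LinearMap.ker p ≤ maximalIdeal R • (⊤ : Submodule R (Fin b → R)))
    (hXD : ∀ i, ExtVanish R (i + 1) X D) (n : ℕ)
    (hn : ExtVanish R (n + 1) (R ⧸ maximalIdeal R) (X →ₗ[R] D)) :
    ExtVanish R n (R ⧸ maximalIdeal R) (LinearMap.ker p →ₗ[R] D) := by
  have hs := isSES_ker p hp
  have hd := hs.dual (hXD 0)
  refine subsingleton_of_forall_eq 0 fun x => ?_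
  obtain ⟨y, rfl⟩ := Ext.covariant_sequence_exact₃ _ hd.shortExact x rfl (hn.elim _ _)
  exact ext_comp_lcomp_eq_zero _ (by simpa using hker) n D
    (fun i => hs.extVanish_sub (extVanish_of_projective i) (hXD (i + 1))) y

/-- If enough Ext groups vanish and the Ext groups from the residue field to `Hom(X, D)`
eventually vanish, then `X` is projective. -/
lemma projective_of_extVanish_hom {R : Type} [CommRing R] [IsNoetherianRing R]
    [IsLocalRing R] {D : Type} [AddCommGroup D] [Module R D] [Module.Finite R D] [Nontrivial D]
    (N : ℕ) :
    ∀ (X : Type) [AddCommGroup X] [Module R X] [Module.Finite R X],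
      (∀ i, ExtVanish R (i + 1) X D) → (∀ i, ExtVanish R (i + 1) X R) →
      (∀ n, N ≤ n → ExtVanish R n (R ⧸ maximalIdeal R) (X →ₗ[R] D)) →
      Module.Projective R X := by
  induction N with
  | zero =>
    intro X _ _ _ hXD hXR hN
    obtain ⟨b, p, hp, hker⟩ := exists_minimal_cover R X
    have hX : Subsingleton (X →ₗ[R] D) :=
      subsingleton_of_extVanish_residue _ fun n => hN n n.zero_le
    have hK : Subsingleton (LinearMap.ker p →ₗ[R] D) :=
      subsingleton_of_extVanish_residue _ fun n =>
        extVanish_hom_ker p hp hker hXD n (hN (n + 1) (Nat.zero_le _))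
    have hd := (isSES_ker p hp).dual (hXD 0)
    have hF : ∀ φ : (Fin b → R) →ₗ[R] D, φ = 0 := fun φ => by
      obtain ⟨ψ, rfl⟩ := (hd.exact φ).1 (Subsingleton.elim _ _)
      rw [Subsingleton.elim ψ 0, map_zero]
    obtain ⟨d, hd0⟩ := exists_ne (0 : D)
    have hb : IsEmpty (Fin b) := ⟨fun i => hd0 (by
      have := LinearMap.congr_fun (hF ((LinearMap.proj i).smulRight d)) (fun _ => 1)
      simpa using this)⟩
    have : Subsingleton X := hp.subsingleton
    infer_instance
  | succ N ih =>
    intro X _ _ _ hXD hXR hN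
    obtain ⟨b, p, hp, hker⟩ := exists_minimal_cover R X
    have hs := isSES_ker p hp
    have hK : Module.Projective R (LinearMap.ker p) := ih (LinearMap.ker p)
      (fun i => hs.extVanish_sub (extVanish_of_projective i) (hXD (i + 1)))
      (fun i => hs.extVanish_sub (extVanish_of_projective i) (hXR (i + 1)))
      (fun n hn => extVanish_hom_ker p hp hker hXD n (hN (n + 1) (by lia)))
    have : Module.Free R (LinearMap.ker p) := Module.free_of_flat_of_isLocalRing
    have hXK : ExtVanish R 1 X (LinearMap.ker p) :=
      ((hXR 0).pi_right (ι := Fin _)).congr_right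
        (Module.finBasis R (LinearMap.ker p)).equivFun.symm
    obtain ⟨s, hsp⟩ := hs.exists_lift hXK LinearMap.id
    exact Module.Projective.of_split s p hsp

end Projective

section ExtHom
variable {R : Type} [CommRing R] [IsNoetherianRing R] {C M D : Type} [AddCommGroup C] [Module R C]
  [AddCommGroup M] [Module R M] [AddCommGroup D] [Module R D]

lemma surjective_lcomp_of_extVanish [Module.Finite R D]
    (hC0 : ∀ (N : Type) [AddCommGroup N] [Module R N] [Module.Finite R N],
      Subsingleton (C →ₗ[R] N) → Subsingleton N)
    (e : M ≃ₗ[R] (C →ₗ[R] D)) (hCD : ∀ i, ExtVanish R (i + 1) C D)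
    {X K : Type} [AddCommGroup X] [Module R X] [AddCommGroup K] [Module R K] [Module.Finite R K]
    {b : ℕ} {j : K →ₗ[R] (Fin b → R)} {p : (Fin b → R) →ₗ[R] X} (hs : IsSES j p)
    (hXM : ExtVanish R 1 X M) (hX : ∀ i, ExtVanish R (i + 1) C (X →ₗ[R] D)) :
    Function.Surjective (LinearMap.lcomp R D j) := by
  set B := LinearMap.range (LinearMap.lcomp R D j) with hB
  have h1 : IsSES (LinearMap.lcomp R D p) (LinearMap.lcomp R D j).rangeRestrict :=
    ⟨hs.injective_lcomp, LinearMap.surjective_rangeRestrict _, fun φ => by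
      rw [← hs.exact_lcomp φ]
      exact Subtype.ext_iff⟩
  have hCB : ExtVanish R 1 C B := h1.extVanish_right (hCD 0).hom_right (hX 1)
  have h2 := isSES_subtype_mkQ B
  have hQ : Subsingleton ((K →ₗ[R] D) ⧸ B) := by
    refine hC0 _ (subsingleton_of_forall_eq 0 fun f => ?_)
    obtain ⟨f, rfl⟩ := h2.exists_lift hCB f
    obtain ⟨g, hg⟩ := hs.exists_extension hXM (e.symm.toLinearMap ∘ₗ f.flip)
    have hf : f = LinearMap.lcomp R D j ∘ₗ (e.toLinearMap ∘ₗ g).flip := by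
      ext c k
      have := congrArg e (LinearMap.congr_fun hg k)
      simp only [LinearMap.comp_apply, LinearEquiv.coe_coe, LinearEquiv.apply_symm_apply] at this
      simp [this]
    ext c
    rw [hf]
    simp [hB]
  rw [← LinearMap.range_eq_top]
  exact Submodule.Quotient.subsingleton_iff.1 hQ

lemma extVanish_of_extVanish_hom [IsLocalRing R] [Module.Finite R D]
    (hC0 : ∀ (N : Type) [AddCommGroup N] [Module R N] [Module.Finite R N],
      Subsingleton (C →ₗ[R] N) → Subsingleton N)
    (e : M ≃ₗ[R] (C →ₗ[R] D)) (hCD : ∀ i, ExtVanish R (i + 1) C D) (n : ℕ) :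
    ∀ (X : Type) [AddCommGroup X] [Module R X] [Module.Finite R X],
      (∀ i, ExtVanish R (i + 1) X M) → (∀ i, ExtVanish R (i + 1) C (X →ₗ[R] D)) →
      ExtVanish R (n + 1) X D := by
  induction n with
  | zero =>
    intro X _ _ _ hXM hX
    obtain ⟨b, p, hp, -⟩ := exists_minimal_cover R X
    have hs := isSES_ker p hp
    exact hs.extVanish_one (extVanish_of_projective 0)
      (surjective_lcomp_of_extVanish hC0 e hCD hs (hXM 0) hX)
  | succ n ih =>
    intro X _ _ _ hXM hX
    obtain ⟨b, p, hp, -⟩ := exists_minimal_cover R X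
    have hs := isSES_ker p hp
    have hd : IsSES _ _ := ⟨hs.injective_lcomp,
      surjective_lcomp_of_extVanish hC0 e hCD hs (hXM 0) hX, hs.exact_lcomp⟩
    exact hs.extVanish_quotient (ih _
      (fun i => hs.extVanish_sub (extVanish_of_projective i) (hXM (i + 1)))
      (fun i => hd.extVanish_right (hCD i).hom_right (hX (i + 1))))
      (extVanish_of_projective (n + 1))

end ExtHom

section CDual
open IsLocalRing

lemma extVanish_dual_of_extVanish {R : Type} [CommRing R] [IsNoetherianRing R] [IsLocalRing R]
    {C T : Type} [AddCommGroup C] [Module R C] [AddCommGroup T] [Module R T]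
    {n s : ℕ} (hT : ∀ (X : Type) [AddCommGroup X] [Module R X] (i : ℕ), n < i → ExtVanish R i X T)
    (hs : ∀ i, s < i → ExtVanish R i C T) (m : ℕ) :
    ∀ (i : ℕ), s < i → n < i + m → ∀ (X : Type) [AddCommGroup X] [Module R X] [Module.Finite R X],
      (∀ j, ExtVanish R (j + 1) X C) → ExtVanish R i (X →ₗ[R] C) T := by
  induction m with
  | zero => exact fun i _ hn X _ _ _ _ => hT _ i hn
  | succ m ih =>
    intro i hi hn X _ _ _ hX
    obtain ⟨b, p, hp, -⟩ := exists_minimal_cover R X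
    have h := isSES_ker p hp
    exact (h.dual (hX 0)).extVanish_sub (hs i hi).hom_left
      (ih (i + 1) (by lia) (by lia) _
        fun j => h.extVanish_sub (extVanish_of_projective j) (hX (j + 1)))

lemma mem_smul_top_of_range_le {R : Type} [CommRing R] (I : Ideal R) {b : ℕ} {F : Type}
    [AddCommGroup F] [Module R F] (δ : (Fin b → R) →ₗ[R] F)
    (hδ : LinearMap.range δ ≤ I • (⊤ : Submodule R F)) :
    δ ∈ I • (⊤ : Submodule R ((Fin b → R) →ₗ[R] F)) := by
  classical
  have h : δ = ∑ i, LinearMap.smulRightₗ (LinearMap.proj i) (δ (Pi.single i 1)) := by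
    ext; simp [Pi.single_apply]
  rw [h]
  refine Submodule.sum_mem _ fun i _ => ?_
  have h1 := Submodule.mem_map_of_mem (f := (LinearMap.smulRightₗ (LinearMap.proj i) :
    F →ₗ[R] ((Fin b → R) →ₗ[R] F))) (hδ ⟨Pi.single i 1, rfl⟩)
  rw [Submodule.map_smul''] at h1
  exact Submodule.smul_mono le_rfl le_top h1

lemma lcomp_comp_mem_smul_top {R : Type} [CommRing R] (I : Ideal R) {F G C T : Type}
    [AddCommGroup F] [Module R F] [AddCommGroup G] [Module R G] [AddCommGroup C] [Module R C]
    [AddCommGroup T] [Module R T] {s : ℕ}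
    (w : Ext.{0} (ModuleCat.of R (F →ₗ[R] C)) (ModuleCat.of R T) s) (δ : F →ₗ[R] G)
    (hδ : δ ∈ I • (⊤ : Submodule R (F →ₗ[R] G))) :
    (Ext.mk₀ (ModuleCat.ofHom (LinearMap.lcomp R C δ))).comp w (zero_add s) ∈
      I • (⊤ : Submodule R (Ext.{0} (ModuleCat.of R (G →ₗ[R] C)) (ModuleCat.of R T) s)) := by
  refine Submodule.smul_induction_on hδ ?_ ?_
  · intro a ha δ _
    have h : ModuleCat.ofHom (LinearMap.lcomp R C (a • δ)) =
        a • ModuleCat.ofHom (LinearMap.lcomp R C δ) := by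
      ext φ x
      simp
    rw [h, Ext.mk₀_smul, Ext.smul_comp]
    exact Submodule.smul_mem_smul ha trivial
  · intro δ δ' h1 h2
    have h : ModuleCat.ofHom (LinearMap.lcomp R C (δ + δ')) =
        ModuleCat.ofHom (LinearMap.lcomp R C δ) + ModuleCat.ofHom (LinearMap.lcomp R C δ') := by
      ext φ x
      simp
    rw [h, Ext.mk₀_add, Ext.add_comp]
    exact add_mem h1 h2

lemma IsSES.exists_eq_comp {R : Type} [CommRing R] {A B D B' D' Y : Type} [AddCommGroup A]
    [Module R A] [AddCommGroup B] [Module R B] [AddCommGroup D] [Module R D] [AddCommGroup B']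
    [Module R B'] [AddCommGroup D'] [Module R D'] [AddCommGroup Y] [Module R Y]
    {f : A →ₗ[R] B} {g : B →ₗ[R] D} {f' : D →ₗ[R] B'} {g' : B' →ₗ[R] D'} (h : IsSES f g)
    (h' : IsSES f' g') {n : ℕ} (hA : ExtVanish R n A Y) (hD' : ExtVanish R (n + 1) D' Y)
    (w : Ext.{0} (ModuleCat.of R B) (ModuleCat.of R Y) n) :
    ∃ w' : Ext.{0} (ModuleCat.of R B') (ModuleCat.of R Y) n,
      (Ext.mk₀ (ModuleCat.ofHom (f' ∘ₗ g))).comp w' (zero_add n) = w := by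
  obtain ⟨y, rfl⟩ := Ext.contravariant_sequence_exact₂ h.shortExact (ModuleCat.of R Y) w
    (hA.elim _ _)
  obtain ⟨w', rfl⟩ := Ext.contravariant_sequence_exact₁ h'.shortExact (ModuleCat.of R Y) y
    (add_comm 1 n) (hD'.elim _ _)
  refine ⟨w', ?_⟩
  rw [ModuleCat.ofHom_comp]
  exact (Ext.mk₀_comp_mk₀_assoc _ _ _).symm

lemma extVanish_of_forall_gt {R : Type} [CommRing R] [IsNoetherianRing R] [IsLocalRing R]
    {C T : Type} [AddCommGroup C] [Module R C] [Module.Finite R C] [AddCommGroup T] [Module R T]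
    [Module.Finite R T] (hC : Function.Bijective (LinearMap.lsmul R C))
    (hCC : ∀ i, ExtVanish R (i + 1) C C) {n s : ℕ}
    (hT : ∀ (X : Type) [AddCommGroup X] [Module R X] (i : ℕ), n < i → ExtVanish R i X T)
    (hs : ∀ i, s + 1 < i → ExtVanish R i C T) : ExtVanish R (s + 1) C T := by
  obtain ⟨b, p, hp, hker⟩ := exists_minimal_cover R C
  obtain ⟨b₁, q, hq, -⟩ := exists_minimal_cover R (LinearMap.ker p)
  have h0 := isSES_ker p hp
  have h1 := isSES_ker q hq
  have hK : ∀ i, ExtVanish R (i + 1) (LinearMap.ker p) C := fun i =>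
    h0.extVanish_sub (extVanish_of_projective i) (hCC (i + 1))
  have hK1 : ∀ i, ExtVanish R (i + 1) (LinearMap.ker q) C := fun i =>
    h1.extVanish_sub (extVanish_of_projective i) (hK (i + 1))
  have hd0 := h0.dual (hCC 0)
  have hd1 := h1.dual (hK 0)
  have hproj : Module.Projective R (C →ₗ[R] C) :=
    Module.Projective.of_equiv (LinearEquiv.ofBijective _ hC)
  have hvan : ExtVanish R (s + 1 + 1) (LinearMap.ker q →ₗ[R] C) T :=
    extVanish_dual_of_extVanish hT hs (n + 1) _ (by lia) (by lia) _ hK1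
  have hd : (LinearMap.ker p).subtype ∘ₗ q ∈
      maximalIdeal R • (⊤ : Submodule R ((Fin b₁ → R) →ₗ[R] (Fin b → R))) :=
    mem_smul_top_of_range_le _ _ ((LinearMap.range_comp_le_range _ _).trans (by simpa using hker))
  have hW : ExtVanish R (s + 1) ((Fin b → R) →ₗ[R] C) T := by
    have hfin : Module.Finite R (Ext.{0} (ModuleCat.of R ((Fin b → R) →ₗ[R] C))
      (ModuleCat.of R T) (s + 1)) := ModuleCat.finite_ext R _ _ _
    refine (Submodule.subsingleton_iff R).1 (subsingleton_of_bot_eq_top (Eq.symm ?_))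
    refine Submodule.eq_bot_of_le_smul_of_le_jacobson_bot (maximalIdeal R) _
      Module.Finite.fg_top ?_ (maximalIdeal_le_jacobson _)
    intro w _
    obtain ⟨w₂, hw⟩ := hd0.exists_eq_comp hd1 (extVanish_of_projective s) hvan w
    have hlc : LinearMap.lcomp R C q ∘ₗ LinearMap.lcomp R C (LinearMap.ker p).subtype =
      LinearMap.lcomp R C ((LinearMap.ker p).subtype ∘ₗ q) := rfl
    rw [hlc] at hw
    have := lcomp_comp_mem_smul_top _ w₂ _ hd
    rw [hw] at this
    exact this
  rcases isEmpty_or_nonempty (Fin b) with hb | ⟨⟨i⟩⟩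
  · have : Subsingleton C := hp.subsingleton
    exact extVanish_of_projective s
  · classical
    exact hW.of_sum_left (ι := Unit) (fun _ => LinearMap.smulRightₗ (LinearMap.proj i))
      (fun _ => LinearMap.applyₗ (Pi.single i (1 : R))) (by ext; simp)

lemma extVanish_of_finite_injDim {R : Type} [CommRing R] [IsNoetherianRing R] [IsLocalRing R]
    {C T : Type} [AddCommGroup C] [Module R C] [Module.Finite R C] [AddCommGroup T] [Module R T]
    [Module.Finite R T] (hC : Function.Bijective (LinearMap.lsmul R C))
    (hCC : ∀ i, ExtVanish R (i + 1) C C) {n : ℕ}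
    (hT : ∀ (X : Type) [AddCommGroup X] [Module R X] (i : ℕ), n < i → ExtVanish R i X T)
    (i : ℕ) : ExtVanish R (i + 1) C T := by
  have H : ∀ m i, n < i + 1 + m → ExtVanish R (i + 1) C T := by
    intro m
    induction m with
    | zero => exact fun i hi => hT C (i + 1) hi
    | succ m ih =>
      refine fun i hi => extVanish_of_forall_gt hC hCC hT fun j hj => ?_
      obtain ⟨j, rfl⟩ := Nat.exists_eq_add_of_lt (Nat.zero_lt_of_lt hj)
      exact ih _ (by lia)
  exact H n i (by lia)

end CDual

section Evaluation
open IsLocalRing TensorProduct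

section Biduality
variable {R : Type} [CommRing R] (C T X Y : Type) [AddCommGroup C] [Module R C] [AddCommGroup T]
  [Module R T] [AddCommGroup X] [Module R X] [AddCommGroup Y] [Module R Y]

/-- The natural map `X ⊗ Hom(C, T) → Hom(Hom(X, C), T)`. -/
def dualEval : X ⊗[R] (C →ₗ[R] T) →ₗ[R] ((X →ₗ[R] C) →ₗ[R] T) :=
  TensorProduct.lift
    ((LinearMap.llcomp R (X →ₗ[R] C) C T).flip ∘ₗ LinearMap.applyₗ)

variable {C T X Y}

@[simp]
lemma dualEval_tmul (x : X) (h : C →ₗ[R] T) (φ : X →ₗ[R] C) :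
    dualEval C T X (x ⊗ₜ h) φ = h (φ x) := rfl

lemma dualEval_rTensor (δ : X →ₗ[R] Y) (z : X ⊗[R] (C →ₗ[R] T)) :
    dualEval C T Y (δ.rTensor _ z) = dualEval C T X z ∘ₗ LinearMap.lcomp R C δ := by
  induction z with
  | zero => simp
  | tmul x h => ext φ; simp
  | add x y hx hy => rw [map_add, map_add, hx, hy, map_add, LinearMap.add_comp]

lemma dualEval_bijective {b : ℕ} : Function.Bijective (dualEval (R := R) C T (Fin b → R)) := by
  classical
  let β : (((Fin b → R) →ₗ[R] C) →ₗ[R] T) → (Fin b → R) ⊗[R] (C →ₗ[R] T) := fun h =>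
    ∑ i, Pi.single i 1 ⊗ₜ (h ∘ₗ LinearMap.smulRightₗ (LinearMap.proj i))
  refine Function.bijective_iff_has_inverse.2 ⟨β, fun z => ?_, fun h => ?_⟩
  · induction z with
    | zero => simp [β]
    | tmul x h =>
      have hx : ∀ i, dualEval C T (Fin b → R) (x ⊗ₜ h) ∘ₗ LinearMap.smulRightₗ (LinearMap.proj i)
          = x i • h := fun i => by ext c; simp
      simp only [β, hx, ← TensorProduct.smul_tmul, ← TensorProduct.sum_tmul]
      congr 1
      ext j
      simp [Finset.sum_apply, Pi.single_apply]
    | add x y hx hy =>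
      rw [← hx, ← hy]
      simp only [β] at hx hy ⊢
      simp [hx, hy, LinearMap.add_comp, TensorProduct.tmul_add, Finset.sum_add_distrib]
  · refine LinearMap.ext fun φ => ?_
    have hφ : φ = ∑ i, LinearMap.smulRightₗ (LinearMap.proj i) (φ (Pi.single i 1)) := by
      ext i
      simp [Pi.single_apply]
    conv_rhs => rw [hφ]
    simp only [β, map_sum, LinearMap.sum_apply, dualEval_tmul, LinearMap.comp_apply]

end Biduality

lemma injective_lift_applyₗ {R : Type} [CommRing R] [IsNoetherianRing R] [IsLocalRing R]
    {C T : Type} [AddCommGroup C] [Module R C] [Module.Finite R C] [AddCommGroup T] [Module R T]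
    (hC : Function.Bijective (LinearMap.lsmul R C))
    (hCC : ∀ i, ExtVanish R (i + 1) C C) {n : ℕ}
    (hT : ∀ (X : Type) [AddCommGroup X] [Module R X] (i : ℕ), n < i → ExtVanish R i X T)
    (hCT : ∀ i, ExtVanish R (i + 1) C T) :
    Function.Injective (TensorProduct.lift (LinearMap.applyₗ : C →ₗ[R] (C →ₗ[R] T) →ₗ[R] T)) := by
  rw [← LinearMap.ker_eq_bot, LinearMap.ker_eq_bot']
  intro z hz
  obtain ⟨b, p, hp, hker⟩ := exists_minimal_cover R C
  obtain ⟨b₁, q, hq, -⟩ := exists_minimal_cover R (LinearMap.ker p)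
  have h0 := isSES_ker p hp
  have h1 := isSES_ker q hq
  have hK : ∀ i, ExtVanish R (i + 1) (LinearMap.ker p) C := fun i =>
    h0.extVanish_sub (extVanish_of_projective i) (hCC (i + 1))
  have hK1 : ∀ i, ExtVanish R (i + 1) (LinearMap.ker q) C := fun i =>
    h1.extVanish_sub (extVanish_of_projective i) (hK (i + 1))
  have hd0 := h0.dual (hCC 0)
  have hd1 := h1.dual (hK 0)
  have hvan : ExtVanish R 1 (LinearMap.ker q →ₗ[R] C) T :=
    extVanish_dual_of_extVanish (s := 0) hT (fun i hi => by
      obtain ⟨j, rfl⟩ := Nat.exists_eq_add_of_lt hi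
      simpa using hCT j) (n + 1) _ (by lia) (by lia) _ hK1
  have hz0 : dualEval C T C z = 0 := by
    have h : ∀ r : R, ∀ z, dualEval C T C z (LinearMap.lsmul R C r) =
        r • TensorProduct.lift (LinearMap.applyₗ : C →ₗ[R] (C →ₗ[R] T) →ₗ[R] T) z := by
      intro r z
      induction z with
      | zero => simp
      | tmul x h => simp
      | add x y hx hy => simp [hx, hy]
    ext φ
    obtain ⟨r, rfl⟩ := hC.2 φ
    rw [h, hz, smul_zero, LinearMap.zero_apply]
  obtain ⟨z₀, rfl⟩ := LinearMap.rTensor_surjective (C →ₗ[R] T) hp z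
  rw [dualEval_rTensor] at hz0
  obtain ⟨y, hy⟩ := (hd0.exact_lcomp _).1 hz0
  obtain ⟨h₁, rfl⟩ := hd1.exists_extension hvan y
  obtain ⟨z₁, rfl⟩ := dualEval_bijective.2 h₁
  have hz₁ : ((LinearMap.ker p).subtype ∘ₗ q).rTensor _ z₁ = z₀ := by
    refine dualEval_bijective.1 ?_
    rw [dualEval_rTensor]
    exact hy
  have hpq : p ∘ₗ ((LinearMap.ker p).subtype ∘ₗ q) = 0 := by
    ext x
    simp
  rw [← hz₁, ← LinearMap.comp_apply, ← LinearMap.rTensor_comp, hpq, LinearMap.rTensor_zero,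
    LinearMap.zero_apply]

lemma subsingleton_of_subsingleton_tensorProduct {R : Type} [CommRing R] [IsLocalRing R]
    {C N : Type} [AddCommGroup C] [Module R C] [Module.Finite R C] [Nontrivial C]
    [AddCommGroup N] [Module R N] [Module.Finite R N] [Subsingleton (C ⊗[R] N)] :
    Subsingleton N := by
  have hk : Nontrivial (ResidueField R ⊗[R] C) := by
    rw [← not_subsingleton_iff_nontrivial, subsingleton_tensorProduct]
    exact not_subsingleton C
  obtain ⟨v, hv⟩ := exists_ne (0 : ResidueField R ⊗[R] C)
  obtain ⟨f, hf⟩ :=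
    not_forall.1 ((Module.forall_dual_apply_eq_zero_iff (ResidueField R) v).not.2 hv)
  have hsurj : Function.Surjective (f.restrictScalars R) :=
    LinearMap.surjective (f := f) fun h => hf (by rw [h, LinearMap.zero_apply])
  have : Subsingleton ((ResidueField R ⊗[R] C) ⊗[R] N) :=
    (TensorProduct.assoc R (ResidueField R) C N).toEquiv.subsingleton
  rw [← subsingleton_tensorProduct (R := R)]
  exact (LinearMap.rTensor_surjective N hsurj).subsingleton

lemma surjective_mk_flip {R : Type} [CommRing R] [IsNoetherianRing R] [IsLocalRing R]
    {C E : Type} [AddCommGroup C] [Module R C] [Module.Finite R C] [Nontrivial C]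
    [AddCommGroup E] [Module R E] [Module.Finite R E]
    (h : Function.Injective (TensorProduct.lift
      (LinearMap.applyₗ : C →ₗ[R] (C →ₗ[R] C ⊗[R] E) →ₗ[R] C ⊗[R] E))) :
    Function.Surjective (TensorProduct.mk R C E).flip := by
  set η := (TensorProduct.mk R C E).flip with hη
  have hsurj : Function.Surjective (η.lTensor C) := fun z => by
    refine ⟨TensorProduct.lift LinearMap.applyₗ z, h ?_⟩
    generalize TensorProduct.lift (LinearMap.applyₗ : C →ₗ[R] (C →ₗ[R] C ⊗[R] E) →ₗ[R] _) z = t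
    induction t with
    | zero => simp
    | tmul c e => simp [hη]
    | add x y hx hy => simp [hx, hy]
  have hs : Subsingleton (C ⊗[R] ((C →ₗ[R] C ⊗[R] E) ⧸ LinearMap.range η)) := by
    refine subsingleton_of_forall_eq 0 fun z => ?_
    obtain ⟨z, rfl⟩ := LinearMap.lTensor_surjective C (Submodule.mkQ_surjective _) z
    obtain ⟨z, rfl⟩ := hsurj z
    rw [← LinearMap.comp_apply, ← LinearMap.lTensor_comp, LinearMap.range_mkQ_comp,
      LinearMap.lTensor_zero, LinearMap.zero_apply]
  have := subsingleton_of_subsingleton_tensorProduct (R := R) (C := C)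
    (N := (C →ₗ[R] C ⊗[R] E) ⧸ LinearMap.range η)
  rw [← LinearMap.range_eq_top]
  exact Submodule.Quotient.subsingleton_iff.1 this

/-- The natural map `C ⊗ Hom(M, M) → Hom(M, C ⊗ M)` is an isomorphism. -/
lemma homTensorMap_bijective {R : Type} [CommRing R] [IsNoetherianRing R]
    {C M : Type} [AddCommGroup C] [Module R C] [Module.Finite R C]
    [AddCommGroup M] [Module R M] [Module.Finite R M]
    (hC0 : ∀ (N : Type) [AddCommGroup N] [Module R N] [Module.Finite R N],
      Subsingleton (C →ₗ[R] N) → Subsingleton N)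
    (hM : Function.Bijective (TensorProduct.mk R C M).flip)
    (hE : Function.Surjective (TensorProduct.mk R C (M →ₗ[R] M)).flip)
    (hCT : ExtVanish R 1 C (C ⊗[R] (M →ₗ[R] M))) :
    Function.Bijective (homTensorMap R C M M) := by
  set φ := homTensorMap R C M M with hφ
  have hφη : ∀ g : M →ₗ[R] M, φ ∘ₗ (TensorProduct.mk R C (M →ₗ[R] M)).flip g =
      ((TensorProduct.mk R C M).flip ∘ₗ g).flip := fun g => rfl
  have hinj : Function.Injective φ := by
    rw [← LinearMap.ker_eq_bot]
    refine (Submodule.subsingleton_iff_eq_bot).1 (hC0 _ (subsingleton_of_forall_eq 0 fun f => ?_))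
    obtain ⟨g, hg⟩ := hE ((LinearMap.ker φ).subtype ∘ₗ f)
    have h0 : φ ∘ₗ (TensorProduct.mk R C (M →ₗ[R] M)).flip g = 0 := by
      rw [hg]
      ext c
      simp
    rw [hφη] at h0
    have hg0 : g = 0 := by
      ext m
      refine hM.1 ?_
      ext c
      simpa using LinearMap.congr_fun (LinearMap.congr_fun h0 c) m
    ext c
    simpa [hg0] using (LinearMap.congr_fun hg c).symm
  refine ⟨hinj, ?_⟩
  have hs : IsSES φ (LinearMap.range φ).mkQ :=
    ⟨hinj, Submodule.mkQ_surjective _, LinearMap.exact_map_mkQ_range φ⟩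
  rw [← LinearMap.range_eq_top]
  refine Submodule.Quotient.subsingleton_iff.1 (hC0 _ (subsingleton_of_forall_eq 0 fun f => ?_))
  obtain ⟨f, rfl⟩ := hs.exists_lift hCT f
  let e := LinearEquiv.ofBijective _ hM
  have hf : f = φ ∘ₗ (TensorProduct.mk R C (M →ₗ[R] M)).flip (e.symm.toLinearMap ∘ₗ f.flip) := by
    rw [hφη]
    ext c m
    exact (LinearMap.congr_fun (e.apply_symm_apply (f.flip m)) c).symm
  rw [hf, ← LinearMap.comp_assoc, LinearMap.range_mkQ_comp, LinearMap.zero_comp]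

end Evaluation

lemma subsingleton_of_hom {R : Type} [CommRing R] [IsNoetherianRing R] {C : Type}
    [AddCommGroup C] [Module R C] [Module.Finite R C]
    (hC : Function.Injective (LinearMap.lsmul R C)) (N : Type) [AddCommGroup N] [Module R N]
    [Module.Finite R N] (h : Subsingleton (C →ₗ[R] N)) : Subsingleton N := by
  obtain ⟨r, hr, hreg⟩ := IsSMulRegular.subsingleton_linearMap_iff.1 h
  have h0 : r = 0 := hC (by
    ext c
    simpa using Module.mem_annihilator.1 hr c)
  subst h0
  exact ⟨fun x y => hreg (by simp)⟩

end AuslanderReiten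

open AuslanderReiten TensorProduct

theorem auslander_reiten_of_finite_C_injdim_endo
    (R : Type) [CommRing R] [IsNoetherianRing R] [IsLocalRing R]
    (C : Type) [AddCommGroup C] [Module R C] [Module.Finite R C]
    (hC : IsSemidualizing R C)
    (M : Type) [AddCommGroup M] [Module R M] [Module.Finite R M]
    (hM : MemAuslanderClass R C M)
    (hCinj : HasFiniteInjDim R (TensorProduct R C (M →ₗ[R] M)))
    (hextR : ∀ i : ℕ, 1 ≤ i → Subsingleton (extMod R i M R))
    (hextM : ∀ i : ℕ, 1 ≤ i → Subsingleton (extMod R i M M)) :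
    Module.Free R M := by
  rcases subsingleton_or_nontrivial M with _ | _
  · infer_instance
  have hCC : ∀ i, ExtVanish R (i + 1) C C := fun i =>
    extVanish_of_extMod (hC.ext_vanish (i + 1) (Nat.le_add_left 1 i))
  have hCD : ∀ i, ExtVanish R (i + 1) C (C ⊗[R] M) := fun i =>
    extVanish_of_extMod (hM.ext_vanish (i + 1) (Nat.le_add_left 1 i))
  have hMR : ∀ i, ExtVanish R (i + 1) M R := fun i =>
    extVanish_of_extMod (hextR (i + 1) (Nat.le_add_left 1 i))
  have hMM : ∀ i, ExtVanish R (i + 1) M M := fun i =>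
    extVanish_of_extMod (hextM (i + 1) (Nat.le_add_left 1 i))
  obtain ⟨n, hn⟩ := hCinj
  have hT : ∀ (X : Type) [AddCommGroup X] [Module R X] (i : ℕ), n < i →
      ExtVanish R i X (C ⊗[R] (M →ₗ[R] M)) := fun X _ _ i hi => by
    obtain ⟨j, rfl⟩ := Nat.exists_eq_succ_of_ne_zero (Nat.ne_zero_of_lt hi)
    exact extVanish_of_extMod (hn X (j + 1) hi)
  have hD : Nontrivial (C ⊗[R] M) := by
    by_contra h
    rw [not_nontrivial_iff_subsingleton] at h
    exact not_subsingleton M hM.bijective.1.subsingleton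
  have hCn : Nontrivial C := by
    by_contra h
    rw [not_nontrivial_iff_subsingleton] at h
    exact not_subsingleton R hC.bijective.1.subsingleton
  have hC0 : ∀ (N : Type) [AddCommGroup N] [Module R N] [Module.Finite R N],
      Subsingleton (C →ₗ[R] N) → Subsingleton N :=
    fun N _ _ _ => subsingleton_of_hom hC.bijective.1 N
  have hCT : ∀ i, ExtVanish R (i + 1) C (C ⊗[R] (M →ₗ[R] M)) :=
    extVanish_of_finite_injDim hC.bijective hCC hT
  let e : C ⊗[R] (M →ₗ[R] M) ≃ₗ[R] (M →ₗ[R] C ⊗[R] M) :=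
    LinearEquiv.ofBijective _ (homTensorMap_bijective hC0 hM.bijective
      (surjective_mk_flip (injective_lift_applyₗ hC.bijective hCC hT hCT)) (hCT 0))
  have hMD : ∀ i, ExtVanish R (i + 1) M (C ⊗[R] M) := fun i =>
    extVanish_of_extVanish_hom hC0 (LinearEquiv.ofBijective _ hM.bijective) hCD i M hMM
      fun j => (hCT j).congr_right e
  have : Module.Projective R M := projective_of_extVanish_hom (n + 1) M hMD hMR
    fun i hi => (hT _ i hi).congr_right e
  exact Module.free_of_flat_of_isLocalRing
end
end

section
/- Let R be a commutative Noetherian local ring of Krull dimension d, C a semidualizing R-module, and M a finitely generated R-module such that Hom_R(M,M) is nonzero with depth(Hom_R(M,M)) = d and Hom_R(M,M) has finite C-injective dimension. Then R is Cohen-Macaulay and C is a canonical module for R (i.e., C has finite injective dimension). -/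
open CategoryTheory

noncomputable section

open TensorProduct IsLocalRing

section Duality

variable {S : Type} [CommRing S]

/-- The evaluation map `Z ⊗ Hom(C, I) → Hom(Hom(Z, C), I)`. -/
def tensorHomEval (Z C I : Type) [AddCommGroup Z] [Module S Z] [AddCommGroup C] [Module S C]
    [AddCommGroup I] [Module S I] : Z ⊗[S] (C →ₗ[S] I) →ₗ[S] ((Z →ₗ[S] C) →ₗ[S] I) :=
  TensorProduct.lift
    (LinearMap.mk₂ S (fun z f => f.comp (LinearMap.applyₗ z))
      (fun _ _ _ => by ext; simp) (fun _ _ _ => by ext; simp)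
      (fun _ _ _ => by ext; simp) (fun _ _ _ => by ext; simp))

variable {Z Z' C I : Type} [AddCommGroup Z] [Module S Z] [AddCommGroup Z'] [Module S Z']
  [AddCommGroup C] [Module S C] [AddCommGroup I] [Module S I]

@[simp]
lemma tensorHomEval_tmul (z : Z) (f : C →ₗ[S] I) (φ : Z →ₗ[S] C) :
    tensorHomEval Z C I (z ⊗ₜ f) φ = f (φ z) := rfl

lemma tensorHomEval_naturality (p : Z →ₗ[S] Z') (u : Z ⊗[S] (C →ₗ[S] I)) :
    tensorHomEval Z' C I (p.rTensor _ u) =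
      (tensorHomEval Z C I u).comp (LinearMap.lcomp S C p) := by
  induction u with
  | zero => simp
  | tmul z f => ext φ; simp
  | add a b ha hb => simp only [map_add, ha, hb, LinearMap.add_comp]

lemma tensorHomEval_bijective_of_free [Module.Free S Z] [Module.Finite S Z] :
    Function.Bijective (tensorHomEval (S := S) Z C I) := by
  classical
  let b := Module.Free.chooseBasis S Z
  have hsum : ∀ φ : Z →ₗ[S] C, φ = ∑ i, (b.coord i).smulRight (φ (b i)) := by
    intro φ
    refine b.ext fun j => ?_
    simp [Finsupp.single_apply]
  have hinv : ∀ u : Z ⊗[S] (C →ₗ[S] I), u = ∑ i, b i ⊗ₜ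
      ((tensorHomEval Z C I u).comp (LinearMap.smulRightₗ (b.coord i))) := by
    intro u
    induction u with
    | zero => simp
    | tmul z f =>
      have : ∀ i, ((tensorHomEval Z C I (z ⊗ₜ f)).comp (LinearMap.smulRightₗ (b.coord i)))
          = b.repr z i • f := by
        intro i; ext c; simp
      simp only [this]
      conv_lhs => rw [← b.sum_repr z, TensorProduct.sum_tmul]
      simp only [TensorProduct.smul_tmul]
    | add a b ha hb =>
      simp only [map_add, LinearMap.add_comp, TensorProduct.tmul_add, Finset.sum_add_distrib]
      rw [← ha, ← hb]
  constructor
  · intro u v huv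
    rw [hinv u, hinv v, huv]
  · intro g
    refine ⟨∑ i, b i ⊗ₜ (g.comp (LinearMap.smulRightₗ (b.coord i))), ?_⟩
    ext φ
    conv_rhs => rw [hsum φ]
    simp

lemma exists_extension_of_injective [Module.Injective S I] (f : Z →ₗ[S] Z')
    (hf : Function.Injective f) (g : Z →ₗ[S] I) : ∃ h : Z' →ₗ[S] I, h.comp f = g := by
  obtain ⟨h, hh⟩ := Module.Injective.out f hf g
  exact ⟨h, LinearMap.ext hh⟩

lemma exists_factor_of_injective [Module.Injective S I] {Y : Type} [AddCommGroup Y] [Module S Y]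
    (f : Z →ₗ[S] Z') (g : Z' →ₗ[S] Y) (hfg : Function.Exact f g) (h : Z' →ₗ[S] I)
    (hh : h.comp f = 0) : ∃ k : Y →ₗ[S] I, k.comp g = h := by
  have hker : LinearMap.ker g ≤ LinearMap.ker h := by
    intro z hz
    obtain ⟨w, rfl⟩ := (hfg z).1 hz
    exact LinearMap.congr_fun hh w
  let h' : (Z' ⧸ LinearMap.ker g) →ₗ[S] I := (LinearMap.ker g).liftQ h hker
  let g' : (Z' ⧸ LinearMap.ker g) →ₗ[S] Y := (LinearMap.ker g).liftQ g le_rfl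
  have hg' : Function.Injective g' := by
    rw [← LinearMap.ker_eq_bot]
    exact Submodule.ker_liftQ_eq_bot _ _ _ le_rfl
  obtain ⟨k, hk⟩ := exists_extension_of_injective g' hg' h'
  exact ⟨k, LinearMap.ext fun z => LinearMap.congr_fun hk (Submodule.Quotient.mk z)⟩

/-- Over a Noetherian ring, `Z ⊗ Hom(C, I) ≃ Hom(Hom(Z, C), I)` for `Z` finite, `I` injective. -/
lemma tensorHomEval_bijective [IsNoetherianRing S] [Module.Finite S Z] [Module.Injective S I] :
    Function.Bijective (tensorHomEval (S := S) Z C I) := by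
  obtain ⟨n, p, hp⟩ := Module.Finite.exists_fin' S Z
  obtain ⟨m, q, hq⟩ := Module.Finite.exists_fin' S (LinearMap.ker p)
  let j : (Fin m → S) →ₗ[S] (Fin n → S) := (LinearMap.ker p).subtype.comp q
  have hj : Function.Exact j p := by
    intro v
    constructor
    · intro hv
      obtain ⟨w, hw⟩ := hq ⟨v, hv⟩
      exact ⟨w, by simp [j, hw]⟩
    · rintro ⟨w, rfl⟩
      exact (q w).2
  have b0 := tensorHomEval_bijective_of_free (S := S) (Z := Fin n → S) (C := C) (I := I)
  have b1 := tensorHomEval_bijective_of_free (S := S) (Z := Fin m → S) (C := C) (I := I)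
  have hpinj : Function.Injective (LinearMap.lcomp S C p) := by
    intro a b hab
    ext z
    obtain ⟨w, rfl⟩ := hp z
    exact LinearMap.congr_fun hab w
  have hex : Function.Exact (LinearMap.lcomp S C p) (LinearMap.lcomp S C j) := by
    intro φ
    constructor
    · intro h
      have hker : LinearMap.ker p ≤ LinearMap.ker φ := by
        intro v hv
        obtain ⟨w, rfl⟩ := (hj v).1 hv
        exact LinearMap.congr_fun h w
      refine ⟨((LinearMap.ker p).liftQ φ hker).comp
        (LinearMap.quotKerEquivOfSurjective p hp).symm.toLinearMap, ?_⟩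
      refine LinearMap.ext fun v => ?_
      have : (LinearMap.quotKerEquivOfSurjective p hp).symm (p v) = Submodule.Quotient.mk v := by
        rw [LinearEquiv.symm_apply_eq]; rfl
      simp [this]
    · rintro ⟨ψ, rfl⟩
      refine LinearMap.ext fun w => ?_
      simp [hj.apply_apply_eq_zero]
  constructor
  · rw [injective_iff_map_eq_zero]
    intro u hu
    obtain ⟨v, rfl⟩ := LinearMap.rTensor_surjective (C →ₗ[S] I) hp u
    rw [tensorHomEval_naturality] at hu
    obtain ⟨k, hk⟩ := exists_factor_of_injective _ _ hex _ hu
    obtain ⟨w, rfl⟩ := b1.2 k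
    rw [← tensorHomEval_naturality] at hk
    rw [← b0.1 hk, ← LinearMap.comp_apply, ← LinearMap.rTensor_comp, hj.linearMap_comp_eq_zero]
    simp
  · intro g
    obtain ⟨k, hk⟩ := exists_extension_of_injective _ hpinj g
    obtain ⟨w, rfl⟩ := b0.2 k
    exact ⟨p.rTensor _ w, by rw [tensorHomEval_naturality, hk]⟩

/-- The endomorphism module of an injective module over a Noetherian ring is flat. -/
lemma flat_end_of_injective [IsNoetherianRing S] [Module.Injective S I] :
    Module.Flat S (I →ₗ[S] I) := by
  rw [Module.Flat.iff_rTensor_injective]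
  intro J hJ
  have b1 := tensorHomEval_bijective (S := S) (Z := J) (C := I) (I := I)
  have hsurj : Function.Surjective (LinearMap.lcomp S I (Submodule.subtype J)) := fun φ =>
    exists_extension_of_injective J.subtype J.injective_subtype φ
  intro u v huv
  apply b1.1
  have := congrArg (tensorHomEval S I I) huv
  rw [tensorHomEval_naturality, tensorHomEval_naturality] at this
  ext1 φ
  obtain ⟨ψ, rfl⟩ := hsurj φ
  exact LinearMap.congr_fun this ψ

end Duality

section Faithful

variable {S : Type} [CommRing S] [IsNoetherianRing S]
  {C : Type} [AddCommGroup C] [Module S C] [Module.Finite S C]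

/-- Tensoring with a finite faithful module over a Noetherian ring reflects zero objects. -/
lemma subsingleton_of_subsingleton_tensorProduct
    (hC : Function.Injective (LinearMap.lsmul S C))
    (Q : Type) [AddCommGroup Q] [Module S Q] [Subsingleton (C ⊗[S] Q)] : Subsingleton Q := by
  by_contra hQ
  rw [not_subsingleton_iff_nontrivial] at hQ
  let 𝒮 : Set (Ideal S) := {J | J • (⊤ : Submodule S Q) ≠ ⊤}
  have hne : 𝒮.Nonempty := ⟨⊥, by simp [𝒮, bot_ne_top]⟩
  obtain ⟨p, hp, hmax⟩ : ∃ p : Ideal S, p ∈ 𝒮 ∧ ∀ J ∈ 𝒮, ¬ p < J :=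
    set_has_maximal_iff_noetherian.2 ‹IsNoetherianRing S› 𝒮 hne
  have htop : ∀ a ∉ p, (p ⊔ Ideal.span {a}) • (⊤ : Submodule S Q) = ⊤ := by
    intro a ha
    by_contra h
    refine hmax _ h (lt_of_le_of_ne le_sup_left fun heq => ha ?_)
    rw [heq]
    exact Ideal.mem_sup_right (Ideal.mem_span_singleton_self a)
  have hprime : p.IsPrime := by
    refine ⟨fun h => hp (by simp [h]), fun {a b} hab => ?_⟩
    by_contra! h
    apply hp
    have hab' : ((p ⊔ Ideal.span {a}) * (p ⊔ Ideal.span {b})) • (⊤ : Submodule S Q) = ⊤ := by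
      rw [Submodule.mul_smul, htop b h.2, htop a h.1]
    refine eq_top_iff.2 (hab'.ge.trans (Submodule.smul_mono_left ?_))
    rw [Ideal.sup_mul, Ideal.mul_sup, Ideal.mul_sup, Ideal.span_singleton_mul_span_singleton]
    refine sup_le (sup_le ?_ ?_) (sup_le ?_ ?_)
    · exact Ideal.mul_le_left
    · exact Ideal.mul_le_left
    · exact Ideal.mul_le_right
    · rwa [Ideal.span_singleton_le_iff_mem]
  obtain ⟨f, hf⟩ : ∃ f : C →ₗ[S] (S ⧸ p), f ≠ 0 := by
    by_contra! h
    have hs : Subsingleton (C →ₗ[S] (S ⧸ p)) := ⟨fun a b => by rw [h a, h b]⟩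
    obtain ⟨r, hr, hreg⟩ := IsSMulRegular.subsingleton_linearMap_iff.1 hs
    have hr0 : r = 0 := hC (by
      ext c
      simpa using Module.mem_annihilator.1 hr c)
    subst hr0
    have : (1 : S ⧸ p) = 0 := hreg (by simp)
    exact one_ne_zero this
  obtain ⟨c, hc⟩ : ∃ c, f c ≠ 0 := by
    by_contra! h
    exact hf (LinearMap.ext h)
  obtain ⟨a, ha⟩ := Ideal.Quotient.mk_surjective (f c)
  have hap : a ∉ p := fun h => hc (by rw [← ha]; exact Ideal.Quotient.eq_zero_iff_mem.2 h)
  apply hp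
  refine eq_top_iff.2 ((htop a hap).ge.trans ?_)
  rw [Submodule.sup_smul]
  refine sup_le le_rfl ?_
  rw [Submodule.ideal_span_singleton_smul]
  rintro _ ⟨q, -, rfl⟩
  have h0 : TensorProduct.quotTensorEquivQuotSMul Q p (f.rTensor Q (c ⊗ₜ q)) = 0 := by
    rw [Subsingleton.elim (c ⊗ₜ[S] q) 0]
    simp
  rw [LinearMap.rTensor_tmul, ← ha, TensorProduct.quotTensorEquivQuotSMul_mk_tmul,
    Submodule.Quotient.mk_eq_zero] at h0
  exact h0

lemma surjective_of_lTensor_surjective (hC : Function.Injective (LinearMap.lsmul S C))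
    {X Y : Type} [AddCommGroup X] [Module S X] [AddCommGroup Y] [Module S Y] (f : X →ₗ[S] Y)
    (hf : Function.Surjective (f.lTensor C)) : Function.Surjective f := by
  have hex := lTensor_exact C (f := f) (g := (LinearMap.range f).mkQ)
    (by rw [LinearMap.exact_iff]; simp) (Submodule.mkQ_surjective _)
  have hs := LinearMap.lTensor_surjective C (Submodule.mkQ_surjective (LinearMap.range f))
  have : Subsingleton (C ⊗[S] (Y ⧸ LinearMap.range f)) := by
    refine subsingleton_of_forall_eq 0 fun u => ?_
    obtain ⟨v, rfl⟩ := hs u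
    exact (hex v).2 (hf v)
  have := subsingleton_of_subsingleton_tensorProduct hC (Y ⧸ LinearMap.range f)
  rw [← LinearMap.range_eq_top]
  exact Submodule.Quotient.subsingleton_iff.1 this

end Faithful

section Flat

variable {S : Type} [CommRing S]
  {Z' F Z X Y W : Type} [AddCommGroup Z'] [Module S Z'] [AddCommGroup F] [Module S F]
  [AddCommGroup Z] [Module S Z] [AddCommGroup X] [Module S X] [AddCommGroup Y] [Module S Y]
  [AddCommGroup W] [Module S W]

/-- If `0 → Z' → F → Z → 0` is a presentation of `Z` with `F` flat that stays exact after tensoring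
with `W`, then tensoring with `Z` preserves the injection in `0 → X → Y → W → 0`. -/
lemma lTensor_injective_of_rTensor_injective [Module.Flat S F]
    (i : Z' →ₗ[S] F) (p : F →ₗ[S] Z) (hip : Function.Exact i p) (hp : Function.Surjective p)
    (f : X →ₗ[S] Y) (g : Y →ₗ[S] W) (hf : Function.Injective f) (hfg : Function.Exact f g)
    (hg : Function.Surjective g) (hW : Function.Injective (i.rTensor W)) :
    Function.Injective (f.lTensor Z) := by
  rw [injective_iff_map_eq_zero]
  intro u hu
  obtain ⟨t, rfl⟩ := LinearMap.rTensor_surjective X hp u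
  have h1 : p.rTensor Y (f.lTensor F t) = 0 := by
    rw [← hu, ← LinearMap.comp_apply, ← LinearMap.comp_apply, LinearMap.rTensor_comp_lTensor,
      LinearMap.lTensor_comp_rTensor]
  obtain ⟨v, hv⟩ := (rTensor_exact Y hip hp _).1 h1
  have h2 : g.lTensor Z' v = 0 := by
    apply hW
    rw [map_zero, ← LinearMap.comp_apply, LinearMap.rTensor_comp_lTensor,
      ← LinearMap.lTensor_comp_rTensor, LinearMap.comp_apply, hv, ← LinearMap.comp_apply,
      ← LinearMap.lTensor_comp, hfg.linearMap_comp_eq_zero]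
    simp
  obtain ⟨w, rfl⟩ := (lTensor_exact Z' hfg hg _).1 h2
  have h3 : t = i.rTensor X w := by
    apply Module.Flat.lTensor_preserves_injective_linearMap (M := F) f hf
    rw [← hv, ← LinearMap.comp_apply, ← LinearMap.comp_apply, LinearMap.rTensor_comp_lTensor,
      LinearMap.lTensor_comp_rTensor]
  rw [h3, ← LinearMap.comp_apply, ← LinearMap.rTensor_comp, hip.linearMap_comp_eq_zero]
  simp

end Flat

section InjectiveDimension

variable {S : Type} [CommRing S]

/-- The module `X` has injective dimension less than `n`. -/
abbrev InjDimLT (S : Type) [CommRing S] (X : Type) [AddCommGroup X] [Module S X] (n : ℕ) : Prop :=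
  HasInjectiveDimensionLT (ModuleCat.of S X) n

lemma injDimLT_one_iff (X : Type) [AddCommGroup X] [Module S X] :
    InjDimLT S X 1 ↔ Module.Injective S X := by
  rw [Module.injective_iff_injective_object, injective_iff_hasInjectiveDimensionLT_one]

lemma exists_injective_embedding (X : Type) [AddCommGroup X] [Module S X] :
    ∃ (I : ModuleCat.{0} S) (f : X →ₗ[S] I), Module.Injective S I ∧ Function.Injective f := by
  obtain ⟨P⟩ := EnoughInjectives.presentation (ModuleCat.of S X)
  exact ⟨P.J, P.f.hom, Module.injective_module_of_injective_object S P.J (inj := P.injective),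
    (ModuleCat.mono_iff_injective _).1 P.mono⟩

variable {X Y W : Type} [AddCommGroup X] [Module S X] [AddCommGroup Y] [Module S Y]
  [AddCommGroup W] [Module S W]

lemma shortExact_of_exact (f : X →ₗ[S] Y) (g : Y →ₗ[S] W) (hf : Function.Injective f)
    (hfg : Function.Exact f g) (hg : Function.Surjective g) :
    (ShortComplex.mk (ModuleCat.ofHom f) (ModuleCat.ofHom g)
      (by ext x; exact hfg.apply_apply_eq_zero x)).ShortExact where
  exact := (ShortComplex.ShortExact.moduleCat_exact_iff_function_exact _).2 hfg
  mono_f := (ModuleCat.mono_iff_injective _).2 hf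
  epi_g := (ModuleCat.epi_iff_surjective _).2 hg

lemma injDimLT_succ_iff [hY : Module.Injective S Y] (f : X →ₗ[S] Y) (g : Y →ₗ[S] W)
    (hf : Function.Injective f) (hfg : Function.Exact f g) (hg : Function.Surjective g) (n : ℕ) :
    InjDimLT S W (n + 1) ↔ InjDimLT S X (n + 2) :=
  (shortExact_of_exact f g hf hfg hg).hasInjectiveDimensionLT_X₃_iff n
    ((Module.injective_iff_injective_object S Y).1 hY)

end InjectiveDimension

/-- A resolution of a module `C = Z 0` by finite free modules `F n`, with syzygies `Z n`, witnessing
that `C` is semidualizing: homotheties are bijective, and every map from a syzygy to `C` extends to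
the ambient free module. -/
structure SemidualizingResolution (S : Type) [CommRing S] where
  Z : ℕ → ModuleCat.{0} S
  F : ℕ → ModuleCat.{0} S
  i : ∀ n, Z (n + 1) →ₗ[S] F n
  p : ∀ n, F n →ₗ[S] Z n
  free : ∀ n, Module.Free S (F n)
  finite : ∀ n, Module.Finite S (F n)
  injective : ∀ n, Function.Injective (i n)
  exact : ∀ n, Function.Exact (i n) (p n)
  surjective : ∀ n, Function.Surjective (p n)
  bijective : Function.Bijective (LinearMap.lsmul S (Z 0))
  extend : ∀ n (f : Z (n + 1) →ₗ[S] Z 0), ∃ g : F n →ₗ[S] Z 0, g ∘ₗ i n = f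

namespace SemidualizingResolution

variable {S : Type} [CommRing S] (r : SemidualizingResolution S)

instance (n : ℕ) : Module.Free S (r.F n) := r.free n
instance (n : ℕ) : Module.Finite S (r.F n) := r.finite n
instance (n : ℕ) : Module.Finite S (r.Z n) := Module.Finite.of_surjective (r.p n) (r.surjective n)

/-- The Bass class of the semidualizing module, restricted to the conditions needed below. -/
structure Bass (X : Type) [AddCommGroup X] [Module S X] : Prop where
  eval : Function.Bijective
    (TensorProduct.lift (LinearMap.applyₗ : r.Z 0 →ₗ[S] (r.Z 0 →ₗ[S] X) →ₗ[S] X))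
  tor : ∀ n, Function.Injective ((r.i n).rTensor (r.Z 0 →ₗ[S] X))

variable [IsNoetherianRing S]

lemma bass_of_injective (X : Type) [AddCommGroup X] [Module S X] [Module.Injective S X] :
    r.Bass X where
  eval := by
    have hev : ∀ u, TensorProduct.lift (LinearMap.applyₗ : r.Z 0 →ₗ[S] (r.Z 0 →ₗ[S] X) →ₗ[S] X) u =
        tensorHomEval (r.Z 0) (r.Z 0) X u LinearMap.id := by
      intro u
      induction u with
      | zero => simp
      | tmul z f => simp
      | add a b ha hb => simp only [map_add, ha, hb, LinearMap.add_apply]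
    have hbij := tensorHomEval_bijective (S := S) (Z := r.Z 0) (C := r.Z 0) (I := X)
    have hid : ∀ φ : r.Z 0 →ₗ[S] r.Z 0, ∃ s : S, φ = s • LinearMap.id := by
      intro φ
      obtain ⟨s, hs⟩ := r.bijective.2 φ
      exact ⟨s, by rw [← hs]; ext; simp⟩
    constructor
    · intro u v huv
      apply hbij.1
      ext φ
      obtain ⟨s, rfl⟩ := hid φ
      rw [hev, hev] at huv
      simp [huv]
    · intro x
      let e := LinearEquiv.ofBijective _ r.bijective
      obtain ⟨u, hu⟩ := hbij.2 ((LinearMap.toSpanSingleton S X x).comp e.symm.toLinearMap)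
      refine ⟨u, ?_⟩
      have he : e 1 = LinearMap.id := by ext; simp [e]
      rw [hev, hu, ← he]
      simp
  tor n := by
    rw [injective_iff_map_eq_zero]
    intro u hu
    apply (tensorHomEval_bijective (S := S) (Z := r.Z (n + 1)) (C := r.Z 0) (I := X)).1
    have h := tensorHomEval_naturality (r.i n) u
    rw [hu, map_zero] at h
    ext f
    obtain ⟨g, rfl⟩ := r.extend n f
    rw [map_zero]
    exact (DFunLike.congr_fun h g).symm

variable {X Y W : Type} [AddCommGroup X] [Module S X] [AddCommGroup Y] [Module S Y]
  [AddCommGroup W] [Module S W]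

lemma Bass.of_exact (f : X →ₗ[S] Y) (g : Y →ₗ[S] W)
    (hf : Function.Injective f) (hfg : Function.Exact f g) (hg : Function.Surjective g)
    (hY : r.Bass Y) (hW : r.Bass W) : r.Bass X := by
  let f' : (r.Z 0 →ₗ[S] X) →ₗ[S] (r.Z 0 →ₗ[S] Y) := f.compRight S
  let g' : (r.Z 0 →ₗ[S] Y) →ₗ[S] (r.Z 0 →ₗ[S] W) := g.compRight S
  have hnat : ∀ {A B : Type} [AddCommGroup A] [Module S A] [AddCommGroup B] [Module S B]
      (h : A →ₗ[S] B) (u : r.Z 0 ⊗[S] (r.Z 0 →ₗ[S] A)),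
      TensorProduct.lift LinearMap.applyₗ ((h.compRight S).lTensor (r.Z 0) u) =
        h (TensorProduct.lift LinearMap.applyₗ u) := by
    intro A B _ _ _ _ h u
    induction u with
    | zero => simp
    | tmul z f => simp
    | add a b ha hb => simp only [map_add, ha, hb]
  have hf' : Function.Injective f' := fun a b hab => by
    ext c
    exact hf (DFunLike.congr_fun hab c)
  have hfg' : Function.Exact f' g' := by
    intro φ
    constructor
    · intro h
      refine ⟨(LinearEquiv.ofInjective f hf).symm.toLinearMap ∘ₗ
        φ.codRestrict (LinearMap.range f) (fun c => (hfg _).1 (DFunLike.congr_fun h c)), ?_⟩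
      ext c
      exact congrArg Subtype.val (LinearEquiv.apply_symm_apply (LinearEquiv.ofInjective f hf) _)
    · rintro ⟨ψ, rfl⟩
      ext c
      exact hfg.apply_apply_eq_zero (ψ c)
  have hg' : Function.Surjective g' := by
    apply surjective_of_lTensor_surjective (C := r.Z 0) r.bijective.1
    intro w
    obtain ⟨y, hy⟩ := hg (TensorProduct.lift LinearMap.applyₗ w)
    obtain ⟨u, rfl⟩ := hY.eval.2 y
    exact ⟨u, hW.eval.1 ((hnat g u).trans hy)⟩
  have hinj : ∀ n, Function.Injective (f'.lTensor (r.Z n)) := fun n =>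
    lTensor_injective_of_rTensor_injective (r.i n) (r.p n) (r.exact n) (r.surjective n)
      f' g' hf' hfg' hg' (hW.tor n)
  refine ⟨⟨fun u v huv => hinj 0 (hY.eval.1 ?_), fun x => ?_⟩, fun n => ?_⟩
  · rw [hnat, hnat, huv]
  · obtain ⟨u, hu⟩ := hY.eval.2 (f x)
    have h0 : g'.lTensor (r.Z 0) u = 0 := by
      apply hW.eval.1
      rw [hnat, hu, hfg.apply_apply_eq_zero, map_zero]
    obtain ⟨v, rfl⟩ := (lTensor_exact (r.Z 0) hfg' hg' u).1 h0
    exact ⟨v, hf ((hnat f v).symm.trans hu)⟩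
  · rw [injective_iff_map_eq_zero]
    intro u hu
    apply hinj (n + 1)
    rw [map_zero]
    apply hY.tor n
    rw [← LinearMap.comp_apply, LinearMap.rTensor_comp_lTensor, ← LinearMap.lTensor_comp_rTensor,
      LinearMap.comp_apply, hu, map_zero, map_zero]

lemma bass_of_injDimLT (m : ℕ) : ∀ (X : Type) [AddCommGroup X] [Module S X],
    InjDimLT S X (m + 1) → r.Bass X := by
  induction m with
  | zero =>
    intro X _ _ h
    have := (injDimLT_one_iff X).1 h
    exact r.bass_of_injective X
  | succ m ih =>
    intro X _ _ h
    obtain ⟨I, f, hI, hf⟩ := exists_injective_embedding (S := S) X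
    have hex : Function.Exact f (LinearMap.range f).mkQ := by rw [LinearMap.exact_iff]; simp
    have hs := Submodule.mkQ_surjective (LinearMap.range f)
    exact Bass.of_exact r f _ hf hex hs (r.bass_of_injective I)
      (ih _ ((injDimLT_succ_iff f _ hf hex hs m).2 h))

/-- If `C ⊗ A` lies in the Bass class, the unit map `A → Hom(C, C ⊗ A)` is bijective. -/
lemma unit_bijective (A : Type) [AddCommGroup A] [Module S A] (h : r.Bass (r.Z 0 ⊗[S] A)) :
    Function.Bijective (TensorProduct.mk S (r.Z 0) A).flip := by
  set γ := (TensorProduct.mk S (r.Z 0) A).flip with hγ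
  have hev : ∀ u, TensorProduct.lift LinearMap.applyₗ (γ.lTensor (r.Z 0) u) = u := by
    intro u
    induction u with
    | zero => simp
    | tmul z f => simp [hγ]
    | add a b ha hb => simp only [map_add, ha, hb]
  have hsurj : Function.Surjective γ := by
    apply surjective_of_lTensor_surjective (C := r.Z 0) r.bijective.1
    intro w
    exact ⟨TensorProduct.lift LinearMap.applyₗ w, h.eval.1 (hev _)⟩
  refine ⟨?_, hsurj⟩
  have hex : Function.Exact (LinearMap.ker γ).subtype γ := by rw [LinearMap.exact_iff]; simp
  have hinj := lTensor_injective_of_rTensor_injective (r.i 0) (r.p 0) (r.exact 0) (r.surjective 0)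
      _ γ (Submodule.subtype_injective _) hex hsurj (h.tor 0)
  have : Subsingleton (r.Z 0 ⊗[S] LinearMap.ker γ) := by
    refine subsingleton_of_forall_eq 0 fun u => hinj ?_
    rw [map_zero, ← hev ((LinearMap.ker γ).subtype.lTensor (r.Z 0) u),
      (lTensor_exact (r.Z 0) hex hsurj).apply_apply_eq_zero, map_zero]
  have := subsingleton_of_subsingleton_tensorProduct r.bijective.1 (LinearMap.ker γ)
  exact LinearMap.ker_eq_bot.1 (Submodule.subsingleton_iff_eq_bot.1 this)

end SemidualizingResolution

section ExtVanishing

variable {S : Type} [CommRing S]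

/-- Vanishing of the `n`-th Ext group of two modules. -/
abbrev ExtVanish (S : Type) [CommRing S] (M N : Type) [AddCommGroup M] [Module S M]
    [AddCommGroup N] [Module S N] (n : ℕ) : Prop :=
  Subsingleton (Abelian.Ext (ModuleCat.of S M) (ModuleCat.of S N) n)

variable {X Y W M : Type} [AddCommGroup X] [Module S X] [AddCommGroup Y] [Module S Y]
  [AddCommGroup W] [Module S W] [AddCommGroup M] [Module S M]

lemma extVanish_zero_iff : ExtVanish S X Y 0 ↔ Subsingleton (X →ₗ[S] Y) :=
  ((Abelian.Ext.addEquiv₀ (X := ModuleCat.of S X) (Y := ModuleCat.of S Y)).toEquiv.trans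
    ModuleCat.homEquiv).subsingleton_congr

lemma InjDimLT.extVanish {n : ℕ} (h : InjDimLT S Y n) {i : ℕ} (hi : n ≤ i) : ExtVanish S X Y i :=
  HasInjectiveDimensionLT.subsingleton _ n i hi _

lemma extVanish_of_injective [Module.Injective S Y] (n : ℕ) : ExtVanish S X Y (n + 1) :=
  ((injDimLT_one_iff Y).2 ‹_›).extVanish (by lia)

lemma extVanish_of_projective [Module.Projective S X] (n : ℕ) : ExtVanish S X Y (n + 1) := by
  have : Projective (ModuleCat.of S X) := inferInstance
  exact subsingleton_of_forall_eq 0 fun e => e.eq_zero_of_projective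

lemma extVanish_congr_left (e : X ≃ₗ[S] Y) {n : ℕ} (h : ExtVanish S X M n) : ExtVanish S Y M n := by
  refine subsingleton_of_forall_eq 0 fun a => ?_
  have h0 : (Abelian.Ext.mk₀ e.symm.toModuleIso.hom).comp
      ((Abelian.Ext.mk₀ e.toModuleIso.hom).comp a (zero_add n)) (zero_add n) = a := by
    rw [Abelian.Ext.mk₀_comp_mk₀_assoc]
    have : e.symm.toModuleIso.hom ≫ e.toModuleIso.hom = 𝟙 _ := by ext; simp
    rw [this, Abelian.Ext.mk₀_id_comp]
  rw [← h0, Subsingleton.elim ((Abelian.Ext.mk₀ e.toModuleIso.hom).comp a (zero_add n)) 0]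
  simp

variable (f : X →ₗ[S] Y) (g : Y →ₗ[S] W)

lemma extVanish_contravariant_middle (hf : Function.Injective f) (hfg : Function.Exact f g)
    (hg : Function.Surjective g) {n : ℕ} (hX : ExtVanish S X M n) (hW : ExtVanish S W M n) :
    ExtVanish S Y M n := by
  refine subsingleton_of_forall_eq 0 fun a => ?_
  obtain ⟨b, rfl⟩ := Abelian.Ext.contravariant_sequence_exact₂ (shortExact_of_exact f g hf hfg hg)
    _ a (hX.elim _ _)
  rw [hW.elim b 0, Abelian.Ext.comp_zero]

lemma extVanish_contravariant_left (hf : Function.Injective f) (hfg : Function.Exact f g)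
    (hg : Function.Surjective g) {n : ℕ} (hY : ExtVanish S Y M n)
    (hW : ExtVanish S W M (n + 1)) : ExtVanish S X M n := by
  refine subsingleton_of_forall_eq 0 fun a => ?_
  obtain ⟨b, rfl⟩ := Abelian.Ext.contravariant_sequence_exact₁ (shortExact_of_exact f g hf hfg hg)
    _ a (add_comm 1 n) (hW.elim _ _)
  rw [hY.elim b 0, Abelian.Ext.comp_zero]

lemma extVanish_covariant_right (hf : Function.Injective f) (hfg : Function.Exact f g)
    (hg : Function.Surjective g) {n : ℕ} (hY : ExtVanish S M Y n)
    (hX : ExtVanish S M X (n + 1)) : ExtVanish S M W n := by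
  refine subsingleton_of_forall_eq 0 fun a => ?_
  obtain ⟨b, rfl⟩ := Abelian.Ext.covariant_sequence_exact₃ _ (shortExact_of_exact f g hf hfg hg)
    a rfl (hX.elim _ _)
  rw [hY.elim b 0, Abelian.Ext.zero_comp]

lemma exists_extension_of_extVanish (hf : Function.Injective f) (hfg : Function.Exact f g)
    (hg : Function.Surjective g) (hW : ExtVanish S W M 1) (φ : X →ₗ[S] M) :
    ∃ ψ : Y →ₗ[S] M, ψ ∘ₗ f = φ := by
  obtain ⟨b, hb⟩ := Abelian.Ext.contravariant_sequence_exact₁ (shortExact_of_exact f g hf hfg hg)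
    _ (Abelian.Ext.mk₀ (ModuleCat.ofHom φ)) (add_comm 1 0) (hW.elim _ _)
  obtain ⟨ψ, rfl⟩ := (Abelian.Ext.mk₀_bijective _ _).2 b
  dsimp at hb
  rw [Abelian.Ext.mk₀_comp_mk₀] at hb
  have h := (Abelian.Ext.mk₀_bijective _ _).1 hb
  exact ⟨ψ.hom, by rw [← ModuleCat.hom_ofHom φ, ← h]; rfl⟩

lemma extVanish_one_of_exists_extension (hf : Function.Injective f) (hfg : Function.Exact f g)
    (hg : Function.Surjective g) [Module.Projective S Y]
    (h : ∀ φ : X →ₗ[S] M, ∃ ψ : Y →ₗ[S] M, ψ ∘ₗ f = φ) : ExtVanish S W M 1 := by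
  refine subsingleton_of_forall_eq 0 fun a => ?_
  obtain ⟨b, rfl⟩ := Abelian.Ext.contravariant_sequence_exact₃ (shortExact_of_exact f g hf hfg hg)
    _ a ((extVanish_of_projective (S := S) (X := Y) (Y := M) 0).elim _ _) (add_comm 1 0)
  obtain ⟨φ, rfl⟩ := (Abelian.Ext.mk₀_bijective _ _).2 b
  obtain ⟨ψ, hψ⟩ := h φ.hom
  have : φ = ModuleCat.ofHom f ≫ ModuleCat.ofHom ψ := by
    ext x
    exact (DFunLike.congr_fun hψ x).symm
  rw [this, ← Abelian.Ext.mk₀_comp_mk₀]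
  exact ShortComplex.ShortExact.extClass_comp_assoc _ _

end ExtVanishing

section QuotientCriterion

variable {S : Type} [CommRing S]

lemma injective_of_forall_extVanish_quotient (N : Type) [AddCommGroup N] [Module S N]
    (h : ∀ J : Ideal S, ExtVanish S (S ⧸ J) N 1) : Module.Injective S N := by
  refine Module.Baer.injective fun J φ => ?_
  obtain ⟨ψ, rfl⟩ := exists_extension_of_extVanish J.subtype J.mkQ (Submodule.subtype_injective J)
    (by rw [LinearMap.exact_iff]; simp) (Submodule.mkQ_surjective J) (h J) φ
  exact ⟨ψ, fun _ _ => rfl⟩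

lemma injDimLT_of_forall_extVanish_quotient (t : ℕ) :
    ∀ (N : Type) [AddCommGroup N] [Module S N],
      (∀ J : Ideal S, ExtVanish S (S ⧸ J) N (t + 1)) → InjDimLT S N (t + 1) := by
  induction t with
  | zero =>
    intro N _ _ h
    exact (injDimLT_one_iff N).2 (injective_of_forall_extVanish_quotient N h)
  | succ t ih =>
    intro N _ _ h
    obtain ⟨I, f, hI, hf⟩ := exists_injective_embedding (S := S) N
    have hex := f.exact_map_mkQ_range
    have hs := Submodule.mkQ_surjective (LinearMap.range f)
    exact (injDimLT_succ_iff f _ hf hex hs t).1 (ih _ fun J =>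
      extVanish_covariant_right f _ hf hex hs (extVanish_of_injective t) (h J))

end QuotientCriterion

section Socle

variable (S : Type) [CommRing S] [IsLocalRing S]

/-- The socle of `X` vanishes. -/
def SocleFree (X : Type) [AddCommGroup X] [Module S X] : Prop :=
  ∀ x : X, (∀ a ∈ maximalIdeal S, a • x = 0) → x = 0

variable {S} {C X : Type} [AddCommGroup C] [Module S C] [AddCommGroup X] [Module S X]

lemma socleFree_iff_subsingleton : SocleFree S X ↔ Subsingleton (S ⧸ maximalIdeal S →ₗ[S] X) := by
  constructor
  · intro h
    refine subsingleton_of_forall_eq 0 fun f => ?_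
    have h1 : f 1 = 0 := h _ fun a ha => by
      rw [← map_smul, ← map_zero f]
      congr 1
      rw [Algebra.smul_def, mul_one]
      exact Ideal.Quotient.eq_zero_iff_mem.2 ha
    refine Submodule.linearMap_qext _ (LinearMap.ext_ring ?_)
    simpa using h1
  · intro h x hx
    let f : S ⧸ maximalIdeal S →ₗ[S] X :=
      Submodule.liftQ _ (LinearMap.toSpanSingleton S X x) fun a ha => by simpa using hx a ha
    have : f 1 = 0 := by rw [Subsingleton.elim f 0]; rfl
    simpa [f] using (show (1 : S) • x = 0 from this)

lemma exists_nonzero_hom_of_socle [Module.Finite S C] [Nontrivial C] (x : X) (hx : x ≠ 0)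
    (hx' : ∀ a ∈ maximalIdeal S, a • x = 0) :
    ∃ h : C →ₗ[S] X, h ≠ 0 ∧ ∀ a ∈ maximalIdeal S, a • h = 0 := by
  obtain ⟨P, hP⟩ := IsCoatomic.exists_coatom (Submodule S C)
  obtain ⟨I, hI, ⟨e⟩⟩ := isSimpleModule_iff_quot_maximal.1 (isSimpleModule_iff_isCoatom.2 hP)
  obtain rfl := IsLocalRing.eq_maximalIdeal hI
  let f : S ⧸ maximalIdeal S →ₗ[S] X :=
    Submodule.liftQ _ (LinearMap.toSpanSingleton S X x) fun a ha => by simpa using hx' a ha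
  refine ⟨f ∘ₗ e.toLinearMap ∘ₗ P.mkQ, fun h => hx ?_, fun a ha => ?_⟩
  · obtain ⟨c, hc⟩ := P.mkQ_surjective (e.symm (Submodule.Quotient.mk 1))
    have h1 : f (e (P.mkQ c)) = 0 := DFunLike.congr_fun h c
    rw [hc, e.apply_symm_apply] at h1
    simpa using (show (1 : S) • x = 0 from h1)
  · ext c
    obtain ⟨s, hs⟩ := Submodule.Quotient.mk_surjective _ (e (P.mkQ c))
    have : f (e (P.mkQ c)) = s • x := by rw [← hs]; rfl
    simp only [LinearMap.smul_apply, LinearMap.comp_apply, LinearEquiv.coe_coe, this,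
      LinearMap.zero_apply]
    rw [smul_comm, hx' a ha, smul_zero]

lemma SocleFree.of_hom_bijective [Module.Finite S C] [Nontrivial C] {B : Type} [AddCommGroup B]
    [Module S B] (γ : B →ₗ[S] (C →ₗ[S] X)) (hγ : Function.Bijective γ) (hB : SocleFree S B) :
    SocleFree S X := by
  intro x hx
  by_contra hne
  obtain ⟨h, hh, hh'⟩ := exists_nonzero_hom_of_socle (C := C) x hne hx
  obtain ⟨b, rfl⟩ := hγ.2 h
  refine hh ?_
  rw [hB b fun a ha => hγ.1 (by rw [map_smul, hh' a ha, map_zero]), map_zero]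

lemma SocleFree.prod {Y : Type} [AddCommGroup Y] [Module S Y] (hX : SocleFree S X)
    (hY : SocleFree S Y) : SocleFree S (X × Y) := fun _ hz =>
  Prod.ext (hX _ fun a ha => congrArg Prod.fst (hz a ha))
    (hY _ fun a ha => congrArg Prod.snd (hz a ha))

variable [IsNoetherianRing S]

lemma exists_isSMulRegular_of_socleFree [Module.Finite S X] (h : SocleFree S X) :
    ∃ x ∈ maximalIdeal S, IsSMulRegular X x := by
  obtain ⟨r, hr, hreg⟩ := IsSMulRegular.subsingleton_linearMap_iff.1
    (socleFree_iff_subsingleton.1 h)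
  rw [Ideal.annihilator_quotient] at hr
  exact ⟨r, hr, hreg⟩

end Socle

section SelfInjective

variable {S : Type} [CommRing S] [IsLocalRing S] [IsNoetherianRing S]

lemma extVanish_quotient_prime {N : Type} [AddCommGroup N] [Module S N] [Module.Finite S N]
    (p : Ideal S) [p.IsPrime] (y : S) (hy : y ∉ p) (hy' : y ∈ maximalIdeal S) (n : ℕ)
    (h : ∀ (M : Type) [AddCommGroup M] [Module S M] [Module.Finite S M], ExtVanish S M N (n + 1)) :
    ExtVanish S (S ⧸ p) N n := by
  let f : (S ⧸ p) →ₗ[S] (S ⧸ p) := LinearMap.lsmul S _ y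
  have hf : Function.Injective f := by
    rw [injective_iff_map_eq_zero]
    intro u hu
    obtain ⟨s, rfl⟩ := Ideal.Quotient.mk_surjective u
    have : Ideal.Quotient.mk p (y * s) = 0 := hu
    rw [Ideal.Quotient.eq_zero_iff_mem] at this ⊢
    exact (Ideal.IsPrime.mem_or_mem ‹_› this).resolve_left hy
  have hse := shortExact_of_exact f _ hf f.exact_map_mkQ_range
    (Submodule.mkQ_surjective (LinearMap.range f))
  have hsurj : ∀ a : Abelian.Ext (ModuleCat.of S (S ⧸ p)) (ModuleCat.of S N) n,
      ∃ b, y • b = a := by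
    intro a
    obtain ⟨b, hb⟩ := Abelian.Ext.contravariant_sequence_exact₁ hse _ a (add_comm 1 n)
      ((h _).elim _ _)
    refine ⟨b, ?_⟩
    rw [← hb]
    have : ModuleCat.ofHom f = y • 𝟙 (ModuleCat.of S (S ⧸ p)) := rfl
    dsimp only
    rw [this, Abelian.Ext.mk₀_smul, Abelian.Ext.smul_comp, Abelian.Ext.mk₀_id_comp]
  have hbot := Submodule.eq_bot_of_le_smul_of_le_jacobson_bot (maximalIdeal S)
    (⊤ : Submodule S (Abelian.Ext (ModuleCat.of S (S ⧸ p)) (ModuleCat.of S N) n))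
    Module.Finite.fg_top (fun a _ => by
      obtain ⟨b, rfl⟩ := hsurj a
      exact Submodule.smul_mem_smul hy' trivial)
    (IsLocalRing.maximalIdeal_le_jacobson _)
  exact subsingleton_of_forall_eq 0 fun a => (Submodule.mem_bot S).1 (hbot ▸ trivial)

lemma injDimLT_descend (hS : ¬ SocleFree S S) (N : Type) [AddCommGroup N] [Module S N]
    [Module.Finite S N] (t : ℕ) (h : InjDimLT S N (t + 2)) : InjDimLT S N (t + 1) := by
  have hk : ExtVanish S (S ⧸ maximalIdeal S) N (t + 1) := by
    simp only [SocleFree, not_forall] at hS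
    obtain ⟨x, hx, hx0⟩ := hS
    let f : S ⧸ maximalIdeal S →ₗ[S] S :=
      Submodule.liftQ _ (LinearMap.toSpanSingleton S S x) fun a ha => by simpa using hx a ha
    have hf : Function.Injective f := by
      rw [injective_iff_map_eq_zero]
      intro u hu
      obtain ⟨s, rfl⟩ := Ideal.Quotient.mk_surjective u
      rw [Ideal.Quotient.eq_zero_iff_mem]
      by_contra hs
      have hs' : IsUnit s := by simpa using hs
      have : s * x = 0 := hu
      exact hx0 (by simpa [hs'.mul_right_eq_zero] using this)
    exact extVanish_contravariant_left f _ hf f.exact_map_mkQ_range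
      (Submodule.mkQ_surjective (LinearMap.range f)) (extVanish_of_projective t)
      (h.extVanish le_rfl)
  have hfin : ∀ (M : Type) [AddCommGroup M] [Module S M] [Module.Finite S M],
      ExtVanish S M N (t + 1) := by
    intro M _ _ hM
    induction hM using IsNoetherianRing.induction_on_isQuotientEquivQuotientPrime S with
    | subsingleton M' => exact extVanish_of_projective t
    | quotient M' p e =>
      refine extVanish_congr_left e.symm ?_
      have := p.2
      by_cases hp : maximalIdeal S ≤ p.1
      · rwa [← (IsLocalRing.maximalIdeal.isMaximal S).eq_of_le p.2.ne_top hp]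
      · obtain ⟨y, hy, hyp⟩ := SetLike.not_le_iff_exists.1 hp
        exact extVanish_quotient_prime p.1 y hyp hy (t + 1)
          fun _ _ _ _ => h.extVanish le_rfl
    | exact M₁ M₂ M₃ f g hf hg hfg h₁ h₃ => exact extVanish_contravariant_middle f g hf hfg hg h₁ h₃
  exact injDimLT_of_forall_extVanish_quotient t N fun J => hfin _

lemma injective_of_injDimLT (hS : ¬ SocleFree S S) (N : Type) [AddCommGroup N] [Module S N]
    [Module.Finite S N] (m : ℕ) (h : InjDimLT S N (m + 1)) : Module.Injective S N := by
  induction m with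
  | zero => exact (injDimLT_one_iff N).1 h
  | succ m ih => exact ih (injDimLT_descend hS N m h)

lemma free_of_not_socleFree (r : SemidualizingResolution S) (hS : ¬ SocleFree S S)
    (A : Type) [AddCommGroup A] [Module S A] [Module.Finite S A]
    (l : A →ₗ[S] (A →ₗ[S] A)) (e : A) (hl : ∀ a, l a e = a) (m : ℕ)
    (h : InjDimLT S (r.Z 0 ⊗[S] A) (m + 1)) : Module.Free S A := by
  have hγ := r.unit_bijective A (r.bass_of_injDimLT m _ h)
  have hinj := injective_of_injDimLT hS _ m h
  have hflat : Module.Flat S ((r.Z 0 ⊗[S] A) →ₗ[S] (r.Z 0 ⊗[S] A)) := flat_end_of_injective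
  let E : (A →ₗ[S] A) ≃ₗ[S] ((r.Z 0 ⊗[S] A) →ₗ[S] (r.Z 0 ⊗[S] A)) :=
    (LinearEquiv.congrRight (LinearEquiv.ofBijective _ hγ)).trans
      ((LinearMap.lflip (R₀ := S)).trans (TensorProduct.lift.equiv (RingHom.id S) _ _ _))
  have : Module.Flat S (A →ₗ[S] A) := Module.Flat.of_linearEquiv E
  have : Module.Flat S A := Module.Flat.of_retract l (LinearMap.applyₗ e) (LinearMap.ext hl)
  exact Module.free_of_flat_of_isLocalRing

end SelfInjective

section QuotientMap

variable {S : Type} [CommRing S] (x : S) {X Y W : Type} [AddCommGroup X] [Module S X]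
  [AddCommGroup Y] [Module S Y] [AddCommGroup W] [Module S W]

lemma quotSMulTop_mk_eq_zero_iff (u : X) :
    (Submodule.Quotient.mk u : QuotSMulTop x X) = 0 ↔ ∃ v, x • v = u := by
  rw [Submodule.Quotient.mk_eq_zero, Submodule.mem_smul_pointwise_iff_exists]
  simp

/-- The map induced on quotients by `x`, linear over the quotient ring. -/
def quotMap (f : X →ₗ[S] Y) : QuotSMulTop x X →ₗ[S ⧸ Ideal.span {x}] QuotSMulTop x Y :=
  (QuotSMulTop.map x f).extendScalarsOfSurjective Ideal.Quotient.mk_surjective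

@[simp]
lemma quotMap_mk (f : X →ₗ[S] Y) (u : X) :
    quotMap x f (Submodule.Quotient.mk u) = Submodule.Quotient.mk (f u) := rfl

lemma quotMap_surjective (f : X →ₗ[S] Y) (hf : Function.Surjective f) :
    Function.Surjective (quotMap x f) := by
  intro u
  obtain ⟨u, rfl⟩ := Submodule.Quotient.mk_surjective _ u
  obtain ⟨v, rfl⟩ := hf u
  exact ⟨Submodule.Quotient.mk v, rfl⟩

lemma quotMap_exact (f : X →ₗ[S] Y) (g : Y →ₗ[S] W) (hfg : Function.Exact f g)
    (hg : Function.Surjective g) : Function.Exact (quotMap x f) (quotMap x g) := by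
  intro u
  obtain ⟨u, rfl⟩ := Submodule.Quotient.mk_surjective _ u
  constructor
  · intro h
    have h' : (Submodule.Quotient.mk (g u) : QuotSMulTop x W) = 0 := h
    obtain ⟨w, hw⟩ := (quotSMulTop_mk_eq_zero_iff x _).1 h'
    obtain ⟨y, rfl⟩ := hg w
    obtain ⟨z, hz⟩ := (hfg (u - x • y)).1 (by rw [map_sub, map_smul, hw, sub_self])
    refine ⟨Submodule.Quotient.mk z, ?_⟩
    rw [quotMap_mk, hz, ← sub_eq_zero, ← Submodule.Quotient.mk_sub, quotSMulTop_mk_eq_zero_iff]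
    exact ⟨-y, by simp⟩
  · rintro ⟨v, hv⟩
    obtain ⟨v, rfl⟩ := Submodule.Quotient.mk_surjective _ v
    rw [← hv, quotMap_mk, quotMap_mk, hfg.apply_apply_eq_zero, Submodule.Quotient.mk_zero]

lemma quotMap_injective (f : X →ₗ[S] Y) (g : Y →ₗ[S] W) (hf : Function.Injective f)
    (hfg : Function.Exact f g) (hW : IsSMulRegular W x) : Function.Injective (quotMap x f) := by
  rw [injective_iff_map_eq_zero]
  intro u hu
  obtain ⟨u, rfl⟩ := Submodule.Quotient.mk_surjective _ u
  have hu' : (Submodule.Quotient.mk (f u) : QuotSMulTop x Y) = 0 := hu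
  obtain ⟨y, hy⟩ := (quotSMulTop_mk_eq_zero_iff x _).1 hu'
  obtain ⟨z, rfl⟩ := (hfg y).1 (hW.right_eq_zero_of_smul
    (by rw [← map_smul, hy, hfg.apply_apply_eq_zero]))
  exact (quotSMulTop_mk_eq_zero_iff x _).2 ⟨z, hf (by rw [map_smul, hy])⟩

open Pointwise in
lemma exact_lsmul_mkQ : Function.Exact (LinearMap.lsmul S X x) (x • (⊤ : Submodule S X)).mkQ :=
  fun u => quotSMulTop_mk_eq_zero_iff x u

lemma exists_quotMap_eq (hY : IsSMulRegular Y x) (h : ExtVanish S X Y 1)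
    (φ : QuotSMulTop x X →ₗ[S ⧸ Ideal.span {x}] QuotSMulTop x Y) :
    ∃ f : X →ₗ[S] Y, quotMap x f = φ := by
  obtain ⟨b, hb⟩ := Abelian.Ext.covariant_sequence_exact₃ _
    (shortExact_of_exact (LinearMap.lsmul S Y x) _ hY (exact_lsmul_mkQ x)
      (Submodule.mkQ_surjective _))
    (Abelian.Ext.mk₀ (ModuleCat.ofHom ((φ.restrictScalars S) ∘ₗ Submodule.mkQ _)))
    (zero_add 1) (h.elim _ _)
  obtain ⟨f, rfl⟩ := (Abelian.Ext.mk₀_bijective _ _).2 b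
  dsimp at hb
  rw [Abelian.Ext.mk₀_comp_mk₀] at hb
  have hb' := congrArg ModuleCat.Hom.hom ((Abelian.Ext.mk₀_bijective _ _).1 hb)
  refine ⟨f.hom, LinearMap.ext fun u => ?_⟩
  obtain ⟨u, rfl⟩ := Submodule.Quotient.mk_surjective _ u
  exact DFunLike.congr_fun hb' u

end QuotientMap

namespace SemidualizingResolution

variable {S : Type} [CommRing S] (r : SemidualizingResolution S)

lemma extVanish_Z (n : ℕ) : ExtVanish S (r.Z n) (r.Z 0) 1 :=
  extVanish_one_of_exists_extension (r.i n) (r.p n) (r.injective n) (r.exact n) (r.surjective n)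
    (r.extend n)

lemma isSMulRegular_Z (x : S) (hS : IsSMulRegular S x) (hC : IsSMulRegular (r.Z 0) x) :
    ∀ n, IsSMulRegular (r.Z n) x
  | 0 => hC
  | n + 1 => by
    have hF : IsSMulRegular (r.F n) x :=
      fun u v huv => (Module.Free.chooseBasis S (r.F n)).repr.injective (Finsupp.ext fun b => hS (by
        simpa only [map_smul, Finsupp.smul_apply] using
          DFunLike.congr_fun (congrArg (Module.Free.chooseBasis S (r.F n)).repr huv) b))
    exact fun u v huv => r.injective n (hF (by
      simpa only [map_smul] using congrArg (r.i n) huv))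

lemma quot_lsmul_bijective (x : S) (hC : IsSMulRegular (r.Z 0) x) :
    Function.Bijective (LinearMap.lsmul (S ⧸ Ideal.span {x}) (QuotSMulTop x (r.Z 0))) := by
  constructor
  · rw [injective_iff_map_eq_zero]
    intro s hs
    obtain ⟨s, rfl⟩ := Ideal.Quotient.mk_surjective s
    rw [Ideal.Quotient.eq_zero_iff_mem, Ideal.mem_span_singleton']
    have hdiv : ∀ c : r.Z 0, ∃ c', x • c' = s • c := fun c => by
      rw [← quotSMulTop_mk_eq_zero_iff]
      exact DFunLike.congr_fun hs (Submodule.Quotient.mk c)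
    choose φ hφ using hdiv
    let ψ : r.Z 0 →ₗ[S] r.Z 0 :=
      { toFun := φ
        map_add' := fun a b => hC (by simp [hφ, smul_add])
        map_smul' := fun t a => hC (by simp [hφ, smul_comm x t, smul_comm s t]) }
    obtain ⟨t, ht⟩ := r.bijective.2 ψ
    refine ⟨t, r.bijective.1 (LinearMap.ext fun c => ?_)⟩
    have : t • c = φ c := DFunLike.congr_fun ht c
    simp [mul_comm t x, mul_smul, this, hφ]
  · intro φ
    obtain ⟨f, rfl⟩ := exists_quotMap_eq x hC (r.extVanish_Z 0) φ
    obtain ⟨s, rfl⟩ := r.bijective.2 f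
    refine ⟨Ideal.Quotient.mk _ s, LinearMap.ext fun u => ?_⟩
    obtain ⟨u, rfl⟩ := Submodule.Quotient.mk_surjective _ u
    rfl

/-- The reduction of a semidualizing resolution modulo a regular element. -/
def quot (x : S) (hS : IsSMulRegular S x) (hC : IsSMulRegular (r.Z 0) x) :
    SemidualizingResolution (S ⧸ Ideal.span {x}) where
  Z n := ModuleCat.of _ (QuotSMulTop x (r.Z n))
  F n := ModuleCat.of _ (QuotSMulTop x (r.F n))
  i n := quotMap x (r.i n)
  p n := quotMap x (r.p n)
  free n := inferInstanceAs (Module.Free (S ⧸ Ideal.span {x}) (QuotSMulTop x (r.F n)))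
  finite n := Module.Finite.of_restrictScalars_finite S (S ⧸ Ideal.span {x})
    (QuotSMulTop x (r.F n))
  injective n := quotMap_injective x _ _ (r.injective n) (r.exact n)
    (r.isSMulRegular_Z x hS hC n)
  exact n := quotMap_exact x _ _ (r.exact n) (r.surjective n)
  surjective n := quotMap_surjective x _ (r.surjective n)
  bijective := r.quot_lsmul_bijective x hC
  extend n φ := by
    obtain ⟨f, rfl⟩ := exists_quotMap_eq x hC (r.extVanish_Z (n + 1)) φ
    obtain ⟨g, rfl⟩ := r.extend n f
    refine ⟨quotMap x g, LinearMap.ext fun u => ?_⟩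
    obtain ⟨u, rfl⟩ := Submodule.Quotient.mk_surjective _ u
    rfl

end SemidualizingResolution

section TorsionInjectiveDimension

variable {S : Type} [CommRing S] (x : S) {X Y W : Type} [AddCommGroup X] [Module S X]
  [AddCommGroup Y] [Module S Y] [AddCommGroup W] [Module S W]

lemma surjective_smul_of_injective (hx : IsSMulRegular S x) [Module.Injective S X] :
    Function.Surjective fun u : X => x • u := by
  intro u
  obtain ⟨h, hh⟩ := Module.Injective.out (LinearMap.lsmul S S x) hx (LinearMap.toSpanSingleton S X u)
  refine ⟨h 1, ?_⟩
  simpa only [← map_smul, LinearMap.lsmul_apply, LinearMap.toSpanSingleton_apply, one_smul]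
    using hh 1

lemma injective_torsionBy [Module.Injective S X] :
    Module.Injective (S ⧸ Ideal.span {x}) (Submodule.torsionBy S X x) := by
  apply Module.Baer.injective
  intro J g
  let J' : Ideal S := J.comap (Ideal.Quotient.mk _)
  let g' : J' →ₗ[S] X :=
    { toFun := fun s => (g ⟨Ideal.Quotient.mk _ s.1, s.2⟩ : X)
      map_add' := fun s t => by
        rw [← Submodule.coe_add, ← map_add]
        rfl
      map_smul' := fun a s => by
        have h := map_smul g (Ideal.Quotient.mk (Ideal.span {x}) a) ⟨Ideal.Quotient.mk _ s.1, s.2⟩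
        exact congrArg Subtype.val h }
  obtain ⟨k, hk⟩ := Module.Baer.of_injective ‹_› J' g'
  have hk1 : ∀ s, k s = s • k 1 := fun s => by rw [← map_smul, smul_eq_mul, mul_one]
  have hxJ : x ∈ J' := by
    have : Ideal.Quotient.mk (Ideal.span {x}) x = 0 :=
      Ideal.Quotient.eq_zero_iff_mem.2 (Ideal.mem_span_singleton_self x)
    change Ideal.Quotient.mk (Ideal.span {x}) x ∈ J
    rw [this]
    exact J.zero_mem
  have hu : k 1 ∈ Submodule.torsionBy S X x := by
    rw [Submodule.mem_torsionBy_iff, ← hk1, hk x hxJ]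
    have : (⟨Ideal.Quotient.mk (Ideal.span {x}) x, hxJ⟩ : J) = 0 :=
      Subtype.ext (Ideal.Quotient.eq_zero_iff_mem.2 (Ideal.mem_span_singleton_self x))
    change (g ⟨Ideal.Quotient.mk (Ideal.span {x}) x, hxJ⟩ : X) = 0
    rw [this, map_zero, Submodule.coe_zero]
  refine ⟨LinearMap.toSpanSingleton _ _ ⟨k 1, hu⟩, fun s hs => ?_⟩
  obtain ⟨s, rfl⟩ := Ideal.Quotient.mk_surjective s
  apply Subtype.ext
  refine Eq.trans ?_ (hk s hs)
  exact (hk1 s).symm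

/-- The map induced on `x`-torsion, linear over the quotient ring. -/
def torsionMap (f : X →ₗ[S] Y) :
    Submodule.torsionBy S X x →ₗ[S ⧸ Ideal.span {x}] Submodule.torsionBy S Y x :=
  LinearMap.extendScalarsOfSurjective (R := S) Ideal.Quotient.mk_surjective
    (f.restrict fun u hu => by
      rw [Submodule.mem_torsionBy_iff] at hu ⊢
      rw [← map_smul, hu, map_zero])

lemma torsionMap_injective (f : X →ₗ[S] Y) (hf : Function.Injective f) :
    Function.Injective (torsionMap x f) := fun _ _ h =>
  Subtype.ext (hf (congrArg Subtype.val h))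

lemma torsionMap_exact (f : X →ₗ[S] Y) (g : Y →ₗ[S] W) (hf : Function.Injective f)
    (hfg : Function.Exact f g) : Function.Exact (torsionMap x f) (torsionMap x g) := by
  intro u
  constructor
  · intro h
    obtain ⟨v, hv⟩ := (hfg u).1 (congrArg Subtype.val h)
    refine ⟨⟨v, ?_⟩, Subtype.ext hv⟩
    rw [Submodule.mem_torsionBy_iff]
    apply hf
    rw [map_smul, hv, map_zero, Submodule.smul_coe_torsionBy]
  · rintro ⟨v, rfl⟩
    exact Subtype.ext (hfg.apply_apply_eq_zero v.1)

lemma torsionMap_surjective (f : X →ₗ[S] Y) (g : Y →ₗ[S] W)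
    (hfg : Function.Exact f g) (hg : Function.Surjective g)
    (hX : Function.Surjective fun u : X => x • u) : Function.Surjective (torsionMap x g) := by
  intro w
  obtain ⟨y, hy⟩ := hg w
  obtain ⟨u, hu⟩ := (hfg (x • y)).1 (by rw [map_smul, hy, Submodule.smul_coe_torsionBy])
  obtain ⟨v, rfl⟩ := hX u
  refine ⟨⟨y - f v, ?_⟩, Subtype.ext ?_⟩
  · rw [Submodule.mem_torsionBy_iff, smul_sub, ← map_smul, hu, sub_self]
  · change g (y - f v) = w
    rw [map_sub, hfg.apply_apply_eq_zero, sub_zero, hy]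

lemma InjDimLT.torsionBy (hx : IsSMulRegular S x) (n : ℕ) :
    ∀ (X : Type) [AddCommGroup X] [Module S X], (Function.Surjective fun u : X => x • u) →
      InjDimLT S X (n + 1) →
      InjDimLT (S ⧸ Ideal.span {x}) (Submodule.torsionBy S X x) (n + 1) := by
  induction n with
  | zero =>
    intro X _ _ _ h
    have := (injDimLT_one_iff X).1 h
    exact (injDimLT_one_iff _).2 (injective_torsionBy x)
  | succ n ih =>
    intro X _ _ hX h
    obtain ⟨I, f, hI, hf⟩ := exists_injective_embedding (S := S) X
    have := injective_torsionBy (S := S) (X := I) x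
    have hq := Submodule.mkQ_surjective (LinearMap.range f)
    refine (injDimLT_succ_iff (torsionMap x f) (torsionMap x (LinearMap.range f).mkQ)
      (torsionMap_injective x f hf) (torsionMap_exact x _ _ hf f.exact_map_mkQ_range)
      (torsionMap_surjective x f _ f.exact_map_mkQ_range hq hX) n).1 (ih _ ?_ ?_)
    · intro u
      obtain ⟨v, rfl⟩ := hq u
      obtain ⟨w, rfl⟩ := surjective_smul_of_injective (X := I) x hx v
      exact ⟨Submodule.mkQ _ w, (map_smul _ _ _).symm⟩
    · exact (injDimLT_succ_iff f _ hf f.exact_map_mkQ_range hq n).2 h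

/-- For an exact sequence `0 → X → Y → W → 0` with `Y` divisible by `x`, the reduction of `X`
modulo `x` is the cokernel of the induced map from the `x`-torsion of `Y` to that of `W`. -/
lemma nonempty_quotSMulTop_equiv (f : X →ₗ[S] Y) (g : Y →ₗ[S] W) (hf : Function.Injective f)
    (hfg : Function.Exact f g) (hg : Function.Surjective g)
    (hY : Function.Surjective fun u : Y => x • u) :
    Nonempty ((Submodule.torsionBy S W x ⧸ LinearMap.range (torsionMap x g))
      ≃ₗ[S ⧸ Ideal.span {x}] QuotSMulTop x X) := by
  let T : Submodule S Y := (LinearMap.range f).comap (LinearMap.lsmul S Y x)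
  let e := LinearEquiv.ofInjective f hf
  let δ : T →ₗ[S] X := e.symm.toLinearMap ∘ₗ
    ((LinearMap.lsmul S Y x) ∘ₗ T.subtype).codRestrict _ (fun t => t.2)
  have hδ : ∀ t : T, f (δ t) = x • t.1 := fun t =>
    congrArg Subtype.val (e.apply_symm_apply _)
  let δ' : T →ₗ[S] QuotSMulTop x X := (Submodule.mkQ _) ∘ₗ δ
  let π : T →ₗ[S] Submodule.torsionBy S W x :=
    (g ∘ₗ T.subtype).codRestrict _ (fun t => by
      obtain ⟨u, hu⟩ := t.2
      rw [Submodule.mem_torsionBy_iff]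
      change x • g t.1 = 0
      rw [← map_smul]
      change f u = x • t.1 at hu
      rw [← hu, hfg.apply_apply_eq_zero])
  let π' : T →ₗ[S] Submodule.torsionBy S W x ⧸ LinearMap.range (torsionMap x g) :=
    ((LinearMap.range (torsionMap x g)).mkQ.restrictScalars S) ∘ₗ π
  have hδ' : Function.Surjective δ' := by
    intro u
    obtain ⟨u, rfl⟩ := Submodule.mkQ_surjective _ u
    obtain ⟨y, hy⟩ := hY (f u)
    refine ⟨⟨y, u, hy.symm⟩, congrArg _ (hf ?_)⟩
    rw [hδ]
    exact hy
  have hπ' : Function.Surjective π' := by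
    intro w
    obtain ⟨w, rfl⟩ := Submodule.mkQ_surjective _ w
    obtain ⟨y, hy⟩ := hg w
    have hyT : x • y ∈ LinearMap.range f := (hfg _).1 (by
      rw [map_smul, hy, Submodule.smul_coe_torsionBy])
    have hπ : π ⟨y, hyT⟩ = w := Subtype.ext hy
    exact ⟨⟨y, hyT⟩, congrArg (LinearMap.range (torsionMap x g)).mkQ hπ⟩
  have hker : LinearMap.ker π' = LinearMap.ker δ' := by
    ext t
    rw [LinearMap.mem_ker, LinearMap.mem_ker]
    have h1 : π' t = 0 ↔ π t ∈ LinearMap.range (torsionMap x g) :=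
      Submodule.Quotient.mk_eq_zero _
    have h2 : δ' t = 0 ↔ ∃ v, x • v = δ t := quotSMulTop_mk_eq_zero_iff x (δ t)
    rw [h1, h2]
    constructor
    · rintro ⟨y, hy⟩
      obtain ⟨v, hv⟩ := (hfg (t.1 - y.1)).1 (by
        rw [map_sub, sub_eq_zero]; exact (congrArg Subtype.val hy).symm)
      refine ⟨v, hf ?_⟩
      rw [map_smul, hv, hδ, smul_sub, Submodule.smul_coe_torsionBy, sub_zero]
    · rintro ⟨v, hv⟩
      refine ⟨⟨t.1 - f v, ?_⟩, Subtype.ext ?_⟩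
      · rw [Submodule.mem_torsionBy_iff, smul_sub, ← map_smul, hv, hδ, sub_self]
      · change g (t.1 - f v) = g t.1
        rw [map_sub, hfg.apply_apply_eq_zero, sub_zero]
  exact ⟨((π'.quotKerEquivOfSurjective hπ').symm.trans ((Submodule.quotEquivOfEq _ _ hker).trans
    (δ'.quotKerEquivOfSurjective hδ'))).extendScalarsOfSurjective Ideal.Quotient.mk_surjective⟩

lemma InjDimLT.of_linearEquiv {n : ℕ} (h : InjDimLT S X n) (e : X ≃ₗ[S] Y) : InjDimLT S Y n :=
  have : HasInjectiveDimensionLT (ModuleCat.of S X) n := h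
  hasInjectiveDimensionLT_of_iso e.toModuleIso n

/-- Reduction modulo a regular element preserves finiteness of the injective dimension. -/
lemma InjDimLT.quotSMulTop (hx : IsSMulRegular S x) (hX : IsSMulRegular X x) (n : ℕ)
    (h : InjDimLT S X (n + 1)) : InjDimLT (S ⧸ Ideal.span {x}) (QuotSMulTop x X) (n + 1) := by
  obtain ⟨I, f, hI, hf⟩ := exists_injective_embedding (S := S) X
  have hq := Submodule.mkQ_surjective (LinearMap.range f)
  have hex := f.exact_map_mkQ_range
  have hdiv := surjective_smul_of_injective (X := I) x hx
  have hI' := injective_torsionBy (S := S) (X := I) x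
  have hT := InjDimLT.torsionBy x hx n (I ⧸ LinearMap.range f) (by
      intro u
      obtain ⟨v, rfl⟩ := hq u
      obtain ⟨w, rfl⟩ := hdiv v
      exact ⟨Submodule.mkQ _ w, (map_smul _ _ _).symm⟩)
    ((injDimLT_succ_iff f _ hf hex hq n).2 (by
      have : HasInjectiveDimensionLT (ModuleCat.of S X) (n + 1) := h
      exact hasInjectiveDimensionLT_of_ge _ (n + 1) _ (by lia)))
  obtain ⟨e⟩ := nonempty_quotSMulTop_equiv x f _ hf hex hq hdiv
  refine InjDimLT.of_linearEquiv ?_ e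
  have hinj : Function.Injective (torsionMap x (LinearMap.range f).mkQ) := by
    rw [injective_iff_map_eq_zero]
    intro u hu
    obtain ⟨v, hv⟩ := (hex u.1).1 (congrArg Subtype.val hu)
    have : v = 0 := hX.right_eq_zero_of_smul
      (hf (by rw [map_smul, hv, Submodule.smul_coe_torsionBy, map_zero]))
    exact Subtype.ext (by rw [← hv, this, map_zero, Submodule.coe_zero])
  refine (shortExact_of_exact _ _ hinj (LinearMap.exact_map_mkQ_range _)
    (Submodule.mkQ_surjective _)).hasInjectiveDimensionLT_X₃ (n + 1) hT ?_
  have : HasInjectiveDimensionLT (ModuleCat.of (S ⧸ Ideal.span {x})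
    (Submodule.torsionBy S I x)) 1 := (injDimLT_one_iff _).2 hI'
  exact hasInjectiveDimensionLT_of_ge _ 1 _ (by lia)

end TorsionInjectiveDimension

section QuotTensor

variable {S : Type} [CommRing S] (x : S) (X Y : Type) [AddCommGroup X] [Module S X]
  [AddCommGroup Y] [Module S Y]

/-- Reduction modulo `x` is base change along the quotient map, linearly over the quotient ring. -/
def quotSMulTopEquivBaseChange :
    QuotSMulTop x X ≃ₗ[S ⧸ Ideal.span {x}] (S ⧸ Ideal.span {x}) ⊗[S] X :=
  (QuotSMulTop.equivQuotTensor x X).extendScalarsOfSurjective Ideal.Quotient.mk_surjective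

/-- Reduction modulo `x` commutes with tensor products. -/
def quotSMulTopTensorEquiv :
    QuotSMulTop x (X ⊗[S] Y) ≃ₗ[S ⧸ Ideal.span {x}]
      QuotSMulTop x X ⊗[S ⧸ Ideal.span {x}] QuotSMulTop x Y :=
  (quotSMulTopEquivBaseChange x (X ⊗[S] Y)).trans
    ((TensorProduct.AlgebraTensorModule.distribBaseChange S (S ⧸ Ideal.span {x}) X Y).trans
      (TensorProduct.congr (quotSMulTopEquivBaseChange x X).symm
        (quotSMulTopEquivBaseChange x Y).symm))

end QuotTensor

section Induction

lemma exists_quotSMulTop_mul {S : Type} [CommRing S] (x : S) {A : Type} [AddCommGroup A]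
    [Module S A] (l : A →ₗ[S] (A →ₗ[S] A)) (e : A) (hl : ∀ a, l a e = a) :
    ∃ (l' : QuotSMulTop x A →ₗ[S ⧸ Ideal.span {x}]
      (QuotSMulTop x A →ₗ[S ⧸ Ideal.span {x}] QuotSMulTop x A)) (e' : QuotSMulTop x A),
      ∀ a, l' a e' = a := by
  let L : QuotSMulTop x A → (QuotSMulTop x A →ₗ[S ⧸ Ideal.span {x}] QuotSMulTop x A) := fun a =>
    quotMap x (l (Function.surjInv (Submodule.Quotient.mk_surjective _) a))
  have hL : ∀ a u : A, L (Submodule.Quotient.mk a) (Submodule.Quotient.mk u) =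
      Submodule.Quotient.mk (l a u) := by
    intro a u
    have h : (Submodule.Quotient.mk (Function.surjInv (Submodule.Quotient.mk_surjective _)
        (Submodule.Quotient.mk a : QuotSMulTop x A)) : QuotSMulTop x A) = Submodule.Quotient.mk a :=
      Function.surjInv_eq _ _
    rw [← sub_eq_zero, ← Submodule.Quotient.mk_sub, quotSMulTop_mk_eq_zero_iff] at h
    obtain ⟨v, hv⟩ := h
    refine (quotMap_mk x _ _).trans ?_
    rw [← sub_eq_zero, ← Submodule.Quotient.mk_sub, quotSMulTop_mk_eq_zero_iff]
    exact ⟨l v u, by rw [← LinearMap.sub_apply, ← map_sub, ← hv, map_smul, LinearMap.smul_apply]⟩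
  refine ⟨⟨⟨L, fun a b => LinearMap.ext fun u => ?_⟩, fun s a => LinearMap.ext fun u => ?_⟩,
    Submodule.Quotient.mk e, fun a => ?_⟩
  · obtain ⟨a, rfl⟩ := Submodule.Quotient.mk_surjective _ a
    obtain ⟨b, rfl⟩ := Submodule.Quotient.mk_surjective _ b
    obtain ⟨u, rfl⟩ := Submodule.Quotient.mk_surjective _ u
    rw [LinearMap.add_apply, hL, hL, ← Submodule.Quotient.mk_add, hL, map_add,
      LinearMap.add_apply, Submodule.Quotient.mk_add]
  · obtain ⟨a, rfl⟩ := Submodule.Quotient.mk_surjective _ a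
    obtain ⟨u, rfl⟩ := Submodule.Quotient.mk_surjective _ u
    obtain ⟨s, rfl⟩ := Ideal.Quotient.mk_surjective s
    have hs : ∀ b : A, Ideal.Quotient.mk (Ideal.span {x}) s •
        (Submodule.Quotient.mk b : QuotSMulTop x A) = Submodule.Quotient.mk (s • b) := fun _ => rfl
    dsimp only
    rw [RingHom.id_apply, LinearMap.smul_apply, hs, hL, hL, hs, map_smul, LinearMap.smul_apply]
  · obtain ⟨a, rfl⟩ := Submodule.Quotient.mk_surjective _ a
    exact (hL a e).trans (congrArg _ (hl a))

variable {R : Type} [CommRing R]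

lemma extVanish_quotSMulTop {S : Type} [CommRing S] [Algebra R S] (x : S)
    {A : Type} [AddCommGroup A] [Module S A] [Module R A] [IsScalarTower R S A]
    (hA : IsSMulRegular A x) (M : Type) [AddCommGroup M] [Module R M] (n : ℕ)
    (h₀ : ExtVanish R M A n) (h₁ : ExtVanish R M A (n + 1)) :
    ExtVanish R M (QuotSMulTop x A) n := by
  let f : A →ₗ[R] A := (LinearMap.lsmul S A x).restrictScalars R
  let g : A →ₗ[R] QuotSMulTop x A := (Submodule.mkQ _ : A →ₗ[S] QuotSMulTop x A).restrictScalars R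
  have hfg : Function.Exact f g := exact_lsmul_mkQ x
  have hg : Function.Surjective g := Submodule.Quotient.mk_surjective _
  have hf : Function.Injective f := hA
  exact extVanish_covariant_right f g hf hfg hg h₀ h₁

variable [IsLocalRing R]

lemma SocleFree.of_surjective_algebraMap {S : Type} [CommRing S] [IsLocalRing S] [Algebra R S]
    (hRS : Function.Surjective (algebraMap R S)) {A : Type} [AddCommGroup A] [Module S A]
    [Module R A] [IsScalarTower R S A] (h : SocleFree R A) : SocleFree S A := by
  have : IsLocalHom (algebraMap R S) := hRS.isLocalHom
  intro u hu
  refine h u fun a ha => ?_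
  rw [← algebraMap_smul S]
  refine hu _ ?_
  rw [mem_maximalIdeal, mem_nonunits_iff] at ha ⊢
  exact fun h' => ha (isUnit_of_map_unit _ _ h')

theorem free_of_extVanish (n : ℕ) : ∀ (S : Type) [CommRing S] [IsNoetherianRing S] [IsLocalRing S]
    [Algebra R S], Function.Surjective (algebraMap R S) → ringKrullDim S = n →
    ∀ (r : SemidualizingResolution S) (A : Type) [AddCommGroup A] [Module S A] [Module R A]
      [IsScalarTower R S A] [Module.Finite S A] (l : A →ₗ[S] (A →ₗ[S] A)) (e : A),
      (∀ a, l a e = a) → ∀ m : ℕ, (∀ i < n, ExtVanish R (R ⧸ maximalIdeal R) A i) →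
      InjDimLT S (r.Z 0 ⊗[S] A) (m + 1) → Module.Free S A := by
  induction n with
  | zero =>
    intro S _ _ _ _ hRS hdim r A _ _ _ _ _ l e hl m _ hinj
    refine free_of_not_socleFree r (fun hS => ?_) A l e hl m hinj
    obtain ⟨x, hx, hreg⟩ := exists_isSMulRegular_of_socleFree hS
    have h := ringKrullDim_quotient_span_singleton_succ_eq_ringKrullDim hreg hx
    have : Nontrivial (S ⧸ Ideal.span {x}) :=
      Ideal.Quotient.nontrivial_iff.2 (by simpa [Ideal.span_singleton_eq_top])
    have h0 : (0 : WithBot ℕ∞) ≤ ringKrullDim (S ⧸ Ideal.span {x}) := ringKrullDim_nonneg_of_nontrivial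
    rw [hdim] at h
    have h1 : (0 : WithBot ℕ∞) + 1 ≤ 0 := (add_le_add_left h0 1).trans h.le
    exact absurd h1 (by decide)
  | succ n ih =>
    intro S _ _ _ _ hRS hdim r A _ _ _ _ _ l e hl m hext hinj
    by_cases hS : SocleFree S S
    swap
    · exact free_of_not_socleFree r hS A l e hl m hinj
    have hnt : Nontrivial (r.Z 0) := by
      by_contra h
      rw [not_nontrivial_iff_subsingleton] at h
      exact one_ne_zero (r.bijective.1 (Subsingleton.elim (LinearMap.lsmul S (r.Z 0) 1) _))
    have hC : SocleFree S (r.Z 0) := SocleFree.of_hom_bijective _ r.bijective hS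
    have hA : SocleFree S A := by
      refine SocleFree.of_surjective_algebraMap hRS (socleFree_iff_subsingleton.2 ?_)
      exact extVanish_zero_iff.1 (hext 0 n.succ_pos)
    have hCA : SocleFree S (r.Z 0 ⊗[S] A) :=
      SocleFree.of_hom_bijective _ (r.unit_bijective A (r.bass_of_injDimLT m _ hinj)) hA
    obtain ⟨x, hx, hreg⟩ := exists_isSMulRegular_of_socleFree ((hS.prod hC).prod (hA.prod hCA))
    have hxS : IsSMulRegular S x :=
      (hreg.of_injective (LinearMap.inl S _ _) LinearMap.inl_injective).of_injective
        (LinearMap.inl S _ _) LinearMap.inl_injective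
    have hxC : IsSMulRegular (r.Z 0) x :=
      (hreg.of_injective (LinearMap.inl S _ _) LinearMap.inl_injective).of_injective
        (LinearMap.inr S _ _) LinearMap.inr_injective
    have hxA : IsSMulRegular A x :=
      (hreg.of_injective (LinearMap.inr S _ _) LinearMap.inr_injective).of_injective
        (LinearMap.inl S _ _) LinearMap.inl_injective
    have hxCA : IsSMulRegular (r.Z 0 ⊗[S] A) x :=
      (hreg.of_injective (LinearMap.inr S _ _) LinearMap.inr_injective).of_injective
        (LinearMap.inr S _ _) LinearMap.inr_injective
    have : Nontrivial (S ⧸ Ideal.span {x}) :=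
      Ideal.Quotient.nontrivial_iff.2 (by simpa [Ideal.span_singleton_eq_top])
    have : IsLocalRing (S ⧸ Ideal.span {x}) :=
      IsLocalRing.of_surjective' (Ideal.Quotient.mk _) Ideal.Quotient.mk_surjective
    have hdim' : ringKrullDim (S ⧸ Ideal.span {x}) = n := by
      have h := ringKrullDim_quotient_span_singleton_succ_eq_ringKrullDim hxS hx
      rw [hdim] at h
      rw [Nat.cast_add, Nat.cast_one] at h
      exact ENat.WithBot.add_one_cancel.1 h
    obtain ⟨l', e', hl'⟩ := exists_quotSMulTop_mul x l e hl
    have : Module.Finite (S ⧸ Ideal.span {x}) (QuotSMulTop x A) :=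
      Module.Finite.of_restrictScalars_finite S _ _
    have hfree := ih (S ⧸ Ideal.span {x}) (Ideal.Quotient.mk_surjective.comp hRS) hdim'
      (r.quot x hxS hxC) (QuotSMulTop x A) l' e' hl' m
      (fun i hi => extVanish_quotSMulTop x hxA _ i (hext i (by lia)) (hext (i + 1) (by lia)))
      ((hinj.quotSMulTop x hxS hxCA m).of_linearEquiv (quotSMulTopTensorEquiv x (r.Z 0) A))
    have : Module.FinitePresentation S A := Module.finitePresentation_of_finite S A
    exact (Module.free_quotSMulTop_iff_free S A
      (by rwa [IsLocalRing.jacobson_eq_maximalIdeal _ bot_ne_top]) hxA).1 hfree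

end Induction

section Comparison

variable {R : Type} [CommRing R]

lemma subsingleton_homology_linearYonedaObj_iff {X : ModuleCat.{0} R} (P : ProjectiveResolution X)
    (Y : ModuleCat.{0} R) (i : ℕ) :
    Subsingleton ((P.complex.linearYonedaObj R Y).homology i) ↔
      ∀ f : P.complex.X i ⟶ Y, P.complex.d (i + 1) i ≫ f = 0 →
        ∃ g : P.complex.X ((ComplexShape.up ℕ).prev i) ⟶ Y,
          P.complex.d i ((ComplexShape.up ℕ).prev i) ≫ g = f := by
  rw [← ModuleCat.isZero_iff_subsingleton, ← HomologicalComplex.exactAt_iff_isZero_homology,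
    HomologicalComplex.exactAt_iff' _ _ i (i + 1) rfl (by simp), ShortComplex.moduleCat_exact_iff]
  rfl

lemma subsingleton_extMod_iff (i : ℕ) (M N : Type) [AddCommGroup M] [Module R M] [AddCommGroup N]
    [Module R N] : Subsingleton (extMod R i M N) ↔ ExtVanish R M N i := by
  let P := projectiveResolution (ModuleCat.of R M)
  have h : Subsingleton (extMod R i M N) ↔
      Subsingleton ((P.complex.linearYonedaObj R (ModuleCat.of R N)).homology i) :=
    (P.isoExt (R := R) i (ModuleCat.of R N)).toLinearEquiv.toEquiv.subsingleton_congr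
  rw [h, subsingleton_homology_linearYonedaObj_iff]
  cases i with
  | zero =>
    have hd : P.complex.d 0 ((ComplexShape.up ℕ).prev 0) = 0 :=
      P.complex.shape _ _ (by simp)
    rw [ExtVanish, Abelian.Ext.addEquiv₀.toEquiv.subsingleton_congr]
    let π : P.complex.X 0 ⟶ ModuleCat.of R M := P.π.f 0
    have hπ : P.complex.d 1 0 ≫ π = 0 := P.complex_d_comp_π_f_zero
    have hex : (ShortComplex.mk _ _ hπ).Exact := P.exact₀
    have : Epi π := inferInstanceAs (Epi (P.π.f 0))
    have : Epi (ShortComplex.mk _ _ hπ).g := this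
    constructor
    · intro h
      refine subsingleton_of_forall_eq 0 fun f => ?_
      obtain ⟨g, hg⟩ := h (π ≫ f) (by rw [← Category.assoc, zero_add, hπ, Limits.zero_comp])
      rw [hd, Limits.zero_comp] at hg
      rw [← cancel_epi π, ← hg, Limits.comp_zero]
    · intro h f hf
      have hf' : π ≫ hex.desc f hf = f := hex.g_desc f hf
      exact ⟨0, by rw [← hf', h.elim (hex.desc f hf) 0, Limits.comp_zero, Limits.comp_zero]⟩
  | succ i =>
    have hp : (ComplexShape.up ℕ).prev (i + 1) = i := by simp
    rw [hp]
    constructor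
    · intro h
      refine subsingleton_of_forall_eq 0 fun α => ?_
      obtain ⟨f, hf, rfl⟩ := P.extMk_surjective α _ rfl
      exact (P.extMk_eq_zero_iff f _ rfl hf i rfl).2 (h f hf)
    · intro h f hf
      exact (P.extMk_eq_zero_iff f _ rfl hf i rfl).1 (h.elim _ _)

lemma hasFiniteInjDim_iff (N : Type) [AddCommGroup N] [Module R N] :
    HasFiniteInjDim R N ↔ ∃ n, InjDimLT R N (n + 1) := by
  constructor
  · rintro ⟨n, hn⟩
    exact ⟨n, hasInjectiveDimensionLT_of_enoughProjectives _ _ fun Y =>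
      (subsingleton_extMod_iff (n + 1) Y N).1 (hn Y (n + 1) n.lt_succ_self)⟩
  · rintro ⟨n, hn⟩
    exact ⟨n, fun M _ _ i hi => (subsingleton_extMod_iff i M N).2 (hn.extVanish hi)⟩

/-- A finite free cover of a finite module. -/
def freeCover (Z : Type) [AddCommGroup Z] [Module R Z] [Module.Finite R Z] :
    (Fin (Module.Finite.exists_fin' R Z).choose → R) →ₗ[R] Z :=
  (Module.Finite.exists_fin' R Z).choose_spec.choose

lemma freeCover_surjective (Z : Type) [AddCommGroup Z] [Module R Z] [Module.Finite R Z] :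
    Function.Surjective (freeCover (R := R) Z) :=
  (Module.Finite.exists_fin' R Z).choose_spec.choose_spec

variable [IsNoetherianRing R]

/-- The syzygies of a finite module in a resolution by finite free modules. -/
def syzygy (C : Type) [AddCommGroup C] [Module R C] [Module.Finite R C] :
    ℕ → {Z : ModuleCat.{0} R // Module.Finite R Z}
  | 0 => ⟨ModuleCat.of R C, ‹_›⟩
  | n + 1 =>
    have := (syzygy C n).2
    ⟨ModuleCat.of R (LinearMap.ker (freeCover (R := R) (syzygy C n).1)),
      inferInstanceAs (Module.Finite R (LinearMap.ker (freeCover (R := R) (syzygy C n).1)))⟩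

instance (C : Type) [AddCommGroup C] [Module R C] [Module.Finite R C] (n : ℕ) :
    Module.Finite R (syzygy (R := R) C n).1 := (syzygy C n).2

lemma extVanish_syzygy (C : Type) [AddCommGroup C] [Module R C] [Module.Finite R C]
    (M : Type) [AddCommGroup M] [Module R M] (h : ∀ i, ExtVanish R C M (i + 1)) (n : ℕ) :
    ∀ i, ExtVanish R (syzygy (R := R) C n).1 M (i + 1) := by
  induction n with
  | zero => exact h
  | succ n ih =>
    intro i
    exact extVanish_contravariant_left
      (LinearMap.ker (freeCover (R := R) (syzygy C n).1)).subtype _ (Submodule.subtype_injective _)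
      (LinearMap.exact_subtype_ker_map _) (freeCover_surjective _) (extVanish_of_projective i)
      (ih (i + 1))

/-- The resolution of a semidualizing module by finite free modules. -/
def IsSemidualizing.resolution {C : Type} [AddCommGroup C] [Module R C] [Module.Finite R C]
    (hC : IsSemidualizing R C) : SemidualizingResolution R where
  Z n := (syzygy C n).1
  F n := ModuleCat.of R (Fin (Module.Finite.exists_fin' R (syzygy (R := R) C n).1).choose → R)
  i n := (LinearMap.ker (freeCover (R := R) (syzygy C n).1)).subtype
  p n := freeCover (syzygy C n).1
  free n := inferInstanceAs (Module.Free R (Fin _ → R))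
  finite n := inferInstanceAs (Module.Finite R (Fin _ → R))
  injective n := Submodule.subtype_injective _
  exact n := LinearMap.exact_subtype_ker_map _
  surjective n := freeCover_surjective _
  bijective := hC.bijective
  extend n := exists_extension_of_extVanish _ _ (Submodule.subtype_injective _)
    (LinearMap.exact_subtype_ker_map _) (freeCover_surjective _)
    (extVanish_syzygy C C (fun i => (subsingleton_extMod_iff (i + 1) C C).1
      (hC.ext_vanish (i + 1) (by lia))) n 0)

end Comparison

section FreeModule

variable {R : Type} [CommRing R]

lemma ExtVanish.of_retract {M X Y : Type} [AddCommGroup M] [Module R M] [AddCommGroup X]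
    [Module R X] [AddCommGroup Y] [Module R Y] (f : X →ₗ[R] Y) (g : Y →ₗ[R] X)
    (hfg : g ∘ₗ f = LinearMap.id) {n : ℕ} (h : ExtVanish R M Y n) : ExtVanish R M X n := by
  refine subsingleton_of_forall_eq 0 fun a => ?_
  have hid : ModuleCat.ofHom f ≫ ModuleCat.ofHom g = 𝟙 (ModuleCat.of R X) := by
    rw [← ModuleCat.ofHom_comp, hfg]
    rfl
  rw [← a.comp_mk₀_id, ← hid, ← Abelian.Ext.mk₀_comp_mk₀,
    ← Abelian.Ext.comp_assoc_of_second_deg_zero,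
    h.elim (a.comp (Abelian.Ext.mk₀ (ModuleCat.ofHom f)) (add_zero n)) 0, Abelian.Ext.zero_comp]

lemma ExtVanish.of_free {M H : Type} [AddCommGroup M] [Module R M] [AddCommGroup H] [Module R H]
    {ι : Type} [Fintype ι] (b : Module.Basis ι R H) {n : ℕ} (h : ExtVanish R M R n) :
    ExtVanish R M H n := by
  refine subsingleton_of_forall_eq 0 fun a => ?_
  have hid : ∑ i, ModuleCat.ofHom (b.coord i) ≫ ModuleCat.ofHom (LinearMap.toSpanSingleton R H (b i))
      = 𝟙 (ModuleCat.of R H) := by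
    ext u
    simp [ModuleCat.hom_sum, LinearMap.sum_apply, b.sum_repr]
  rw [← a.comp_mk₀_id, ← hid, Abelian.Ext.mk₀_sum, Abelian.Ext.comp_sum]
  refine Finset.sum_eq_zero fun i _ => ?_
  rw [← Abelian.Ext.mk₀_comp_mk₀, ← Abelian.Ext.comp_assoc_of_second_deg_zero,
    h.elim (a.comp (Abelian.Ext.mk₀ (ModuleCat.ofHom (b.coord i))) (add_zero n)) 0,
    Abelian.Ext.zero_comp]

end FreeModule

theorem cm_and_canonical_of_endo_depth
    (R : Type) [CommRing R] [IsNoetherianRing R] [IsLocalRing R]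
    (d : ℕ) (hd : ringKrullDim R = d)
    (C : Type) [AddCommGroup C] [Module R C] [Module.Finite R C]
    (hC : IsSemidualizing R C)
    (M : Type) [AddCommGroup M] [Module R M] [Module.Finite R M]
    (hhom : Nontrivial (M →ₗ[R] M))
    (hdepth : moduleDepth R (M →ₗ[R] M) = d)
    (hCinj : HasFiniteInjDim R (TensorProduct R C (M →ₗ[R] M))) :
    moduleDepth R R = d ∧ HasFiniteInjDim R C := by
  obtain ⟨m, hm⟩ := (hasFiniteInjDim_iff _).1 hCinj
  have hext : ∀ i < d, ExtVanish R (R ⧸ maximalIdeal R) (M →ₗ[R] M) i := by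
    intro i hi
    rw [← hdepth] at hi
    exact (subsingleton_extMod_iff i _ _).1 (not_not.1 (Nat.notMem_of_lt_sInf hi))
  have hfin : Module.Finite R (M →ₗ[R] M) := inferInstance
  have hfree : Module.Free R (M →ₗ[R] M) := free_of_extVanish (R := R) d R
    Function.surjective_id hd hC.resolution (M →ₗ[R] M) (LinearMap.llcomp R M M M) LinearMap.id
    (fun f => f.comp_id) m hext hm
  let b := Module.Free.chooseBasis R (M →ₗ[R] M)
  obtain ⟨i⟩ := b.index_nonempty
  have hR : ∀ n, ExtVanish R (R ⧸ maximalIdeal R) R n ↔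
      ExtVanish R (R ⧸ maximalIdeal R) (M →ₗ[R] M) n := fun n =>
    ⟨fun h => h.of_free b, fun h => h.of_retract (LinearMap.toSpanSingleton R _ (b i)) (b.coord i)
      (by ext; simp)⟩
  refine ⟨?_, (hasFiniteInjDim_iff C).2 ⟨m, ?_⟩⟩
  · rw [← hdepth]
    simp only [moduleDepth, subsingleton_extMod_iff, hR]
  · have : HasInjectiveDimensionLT (ModuleCat.of R (C ⊗[R] (M →ₗ[R] M))) (m + 1) := hm
    have hid : (TensorProduct.rid R C).toLinearMap ∘ₗ (b.coord i).lTensor C ∘ₗ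
        (TensorProduct.mk R C _).flip (b i) = LinearMap.id := by
      ext
      simp
    exact Retract.hasInjectiveDimensionLT (Y := ModuleCat.of R (C ⊗[R] (M →ₗ[R] M)))
      ⟨ModuleCat.ofHom ((TensorProduct.mk R C _).flip (b i)),
        ModuleCat.ofHom ((TensorProduct.rid R C).toLinearMap ∘ₗ (b.coord i).lTensor C), by
          rw [← ModuleCat.ofHom_comp, LinearMap.comp_assoc, hid]
          rfl⟩ (m + 1)
end
end
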